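/- arXiv:1608.03335 — 2 statements merged into one kernel-verified Lean document; each statement's English description precedes it below -/
import Mathlib

section
/- Assume the reduced system is uncontrolled, y′(τ) = f(y(τ)), and Assumption III holds. Suppose: (a) for every continuous function q : ℝ^m → ℝ the map z ↦ ∫_{Y_z} q dν_z is continuous on Z; and (b) there is a constant L such that for every function q that is Lipschitz continuous with a fixed common Lipschitz constant L₁ (L₁ a Lipschitz constant in y of the pair (h,r)), the map z ↦ ∫_{Y_z} q dν_z is Lipschitz on Z with constant L. Then the map z ↦ W(z) is continuous on Z and the set-valued map V(z) := {(h̃(μ), r̃(μ)) : μ ∈ W(z)} ⊂ ℝ^{k+1} is Lipschitz on Z in the Hausdorff metric. -/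
open MeasureTheory Set Filter Metric
open scoped ENNReal NNReal Topology

noncomputable section

namespace SlowObs

abbrev Dd (d : ℕ) := EuclideanSpace ℝ (Fin d)
abbrev Em (m : ℕ) := EuclideanSpace ℝ (Fin m)
abbrev Kk (k : ℕ) := EuclideanSpace ℝ (Fin k)

variable {d m k : ℕ}

/-- A control: a measurable function with values in `U` at nonnegative times. -/
def IsControl (U : Set (Dd d)) (u : ℝ → Dd d) : Prop :=
  Measurable u ∧ ∀ t : ℝ, 0 ≤ t → u t ∈ U

/-- Carathéodory (integral-form) solution of `y'(t) = vf t (y t)` on `[0, ∞)`. -/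
def IsSolOn (vf : ℝ → Em m → Em m) (y : ℝ → Em m) : Prop :=
  ContinuousOn y (Ici 0) ∧
    (∀ T : ℝ, IntervalIntegrable (fun s => vf s (y s)) volume 0 T) ∧
    ∀ t : ℝ, 0 ≤ t → y t = y 0 + ∫ s in (0:ℝ)..t, vf s (y s)

/-- The level sets `Y_z = {y : F y = z}` (invariant sets of the reduced system). -/
def lvl (F : Em m → Kk k) (z : Kk k) : Set (Em m) := {y | F y = z}

/-- `h(u,y) := F'(y) g(u,y)`. -/
def hObs (F : Em m → Kk k) (g : Dd d → Em m → Em m) (p : Dd d × Em m) : Kk k :=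
  fderiv ℝ F p.2 (g p.1 p.2)

/-- Occupational measure generated on `[0,S]` by the pair `(u(·), y(·))`:
the pushforward of the normalized Lebesgue measure on `[0,S]` under `τ ↦ (u τ, y τ)`. -/
def occ (u : ℝ → Dd d) (y : ℝ → Em m) (S : ℝ) : Measure (Dd d × Em m) :=
  (ENNReal.ofReal S)⁻¹ • Measure.map (fun τ => (u τ, y τ)) (volume.restrict (Ioc 0 S))

/-- The set `W(z)`. -/
def W (U : Set (Dd d)) (f : Dd d → Em m → Em m) (F : Em m → Kk k) (z : Kk k) :
    Set (Measure (Dd d × Em m)) :=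
  {μ | IsProbabilityMeasure μ ∧ μ (U ×ˢ lvl F z) = 1 ∧
    ∀ φ : Em m → ℝ, ContDiff ℝ 1 φ → ∫ p, fderiv ℝ φ p.2 (f p.1 p.2) ∂μ = 0}

/-- The metric `ρ` on probability measures: the Lévy–Prokhorov (extended) distance. -/
def ρ (μ ν : Measure (Dd d × Em m)) : ℝ≥0∞ := levyProkhorovEDist μ ν

/-- Distance from a measure to a set of measures, `ρ(μ, Γ) = inf_{ν ∈ Γ} ρ(μ,ν)`. -/
def ρpt (μ : Measure (Dd d × Em m)) (Γ : Set (Measure (Dd d × Em m))) : ℝ≥0∞ :=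
  ⨅ ν ∈ Γ, ρ μ ν

/-- The Hausdorff semimetric `ρ_H` on sets of measures. -/
def ρH (Γ₁ Γ₂ : Set (Measure (Dd d × Em m))) : ℝ≥0∞ :=
  max (⨆ μ ∈ Γ₁, ρpt μ Γ₂) (⨆ μ ∈ Γ₂, ρpt μ Γ₁)

/-- Continuity of the set-valued map `z ↦ W(z)` on `Z` with respect to `ρ_H`. -/
def WCont (U : Set (Dd d)) (f : Dd d → Em m → Em m) (F : Em m → Kk k)
    (Z : Set (Kk k)) : Prop :=
  ∀ z ∈ Z, ∀ δ : ℝ≥0∞, 0 < δ → ∃ ε > (0:ℝ), ∀ z' ∈ Z, ‖z' - z‖ < ε →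
    ρH (W U f F z') (W U f F z) < δ

/-- `h̃(μ) = ∫ h dμ`. -/
def htilde (F : Em m → Kk k) (g : Dd d → Em m → Em m) (μ : Measure (Dd d × Em m)) : Kk k :=
  ∫ p, hObs F g p ∂μ

/-- `r̃(μ) = ∫ r dμ`. -/
def rtilde (r : Dd d → Em m → ℝ) (μ : Measure (Dd d × Em m)) : ℝ :=
  ∫ p, r p.1 p.2 ∂μ

/-- The set-valued map `V(z) = {(h̃ μ, r̃ μ) : μ ∈ W(z)} ⊆ ℝ^{k+1}`. -/
def Vmap (U : Set (Dd d)) (f : Dd d → Em m → Em m) (F : Em m → Kk k)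
    (g : Dd d → Em m → Em m) (r : Dd d → Em m → ℝ) (z : Kk k) : Set (Kk k × ℝ) :=
  (fun μ => (htilde F g μ, rtilde r μ)) '' W U f F z

/-- Lipschitz continuity of `V` on `Z` in the Hausdorff metric. -/
def VLip (U : Set (Dd d)) (f : Dd d → Em m → Em m) (F : Em m → Kk k)
    (g : Dd d → Em m → Em m) (r : Dd d → Em m → ℝ) (Z : Set (Kk k)) : Prop :=
  ∃ L : ℝ, 0 ≤ L ∧ ∀ z' ∈ Z, ∀ z'' ∈ Z,
    hausdorffDist (Vmap U f F g r z') (Vmap U f F g r z'') ≤ L * ‖z' - z''‖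

/-- A solution `(μ(·), z(·))` of the averaged system with initial value `z₀`. -/
def IsAveragedSol (U : Set (Dd d)) (f : Dd d → Em m → Em m) (F : Em m → Kk k)
    (g : Dd d → Em m → Em m) (z₀ : Kk k)
    (μt : ℝ → Measure (Dd d × Em m)) (z : ℝ → Kk k) : Prop :=
  z 0 = z₀ ∧ ContinuousOn z (Ici 0) ∧
    (∀ T : ℝ, IntervalIntegrable (fun s => htilde F g (μt s)) volume 0 T) ∧
    (∀ t : ℝ, 0 ≤ t → z t = z₀ + ∫ s in (0:ℝ)..t, htilde F g (μt s)) ∧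
    (∀ t : ℝ, 0 ≤ t → μt t ∈ W U f F (z t))

/-- Viability of the averaged system in `Z`. -/
def AveragedViable (U : Set (Dd d)) (f : Dd d → Em m → Em m) (F : Em m → Kk k)
    (g : Dd d → Em m → Em m) (Z : Set (Kk k)) : Prop :=
  ∀ z₀ ∈ Z, ∃ μt zf, IsAveragedSol U f F g z₀ μt zf ∧ ∀ t : ℝ, 0 ≤ t → zf t ∈ Z

/-- Viability of the augmented perturbed system in `Y × Z`. -/
def AugViable (U : Set (Dd d)) (f g : Dd d → Em m → Em m) (F : Em m → Kk k)
    (Yset : Set (Em m)) (Z : Set (Kk k)) : Prop :=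
  ∀ ε > (0:ℝ), ∀ y₀ ∈ Yset, ∀ z₀ ∈ Z, ∃ u y zf,
    IsControl U u ∧ IsSolOn (fun s x => ε⁻¹ • f (u s) x + g (u s) x) y ∧ y 0 = y₀ ∧
    ContinuousOn zf (Ici 0) ∧ zf 0 = z₀ ∧
    (∀ T : ℝ, IntervalIntegrable (fun s => hObs F g (u s, y s)) volume 0 T) ∧
    (∀ t : ℝ, 0 ≤ t → zf t = z₀ + ∫ s in (0:ℝ)..t, hObs F g (u s, y s)) ∧
    (∀ t : ℝ, 0 ≤ t → y t ∈ Yset ∧ zf t ∈ Z)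

/-- The set `M_z(S, y₀)` of occupational measures on `[0,S]` of reduced solutions from `y₀`. -/
def Mz (U : Set (Dd d)) (f : Dd d → Em m → Em m) (S : ℝ) (y₀ : Em m) :
    Set (Measure (Dd d × Em m)) :=
  {μ | ∃ u y, IsControl U u ∧ IsSolOn (fun s x => f (u s) x) y ∧ y 0 = y₀ ∧ μ = occ u y S}

/-- Assumption 2 of the paper: `sup_{μ ∈ W(z)} ρ(μ, M_z(S,y₀)) ≤ β(S) → 0`,
uniformly over `y₀ ∈ Y_z` and `z ∈ Z`. -/
def Assumption2 (U : Set (Dd d)) (f : Dd d → Em m → Em m) (F : Em m → Kk k)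
    (Z : Set (Kk k)) : Prop :=
  ∃ β : ℝ → ℝ, Tendsto β atTop (𝓝 0) ∧
    ∀ z ∈ Z, ∀ y₀ ∈ lvl F z, ∀ S > (0:ℝ), ∀ μ ∈ W U f F z,
      ρpt μ (Mz U f S y₀) ≤ ENNReal.ofReal (β S)

/-- Optimal value `R^*(ε, y₀)` of the perturbed problem (shrinked time scale). -/
def Rstar (U : Set (Dd d)) (f g : Dd d → Em m → Em m) (r : Dd d → Em m → ℝ)
    (C : ℝ) (y₀ : Em m) (ε : ℝ) : ℝ :=
  sInf {v | ∃ u y, IsControl U u ∧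
    IsSolOn (fun s x => ε⁻¹ • f (u s) x + g (u s) x) y ∧ y 0 = y₀ ∧
    v = ∫ t in Ioi (0:ℝ), Real.exp (-C * t) * r (u t) (y t)}

/-- Optimal value `R̃^*` of the averaged problem. -/
def RtildeStar (U : Set (Dd d)) (f : Dd d → Em m → Em m) (F : Em m → Kk k)
    (g : Dd d → Em m → Em m) (r : Dd d → Em m → ℝ) (C : ℝ) (z₀ : Kk k) : ℝ :=
  sInf {v | ∃ μt z, IsAveragedSol U f F g z₀ μt z ∧
    v = ∫ t in Ioi (0:ℝ), Real.exp (-C * t) * rtilde r (μt t)}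

/-- Bilinear form `wᵀ Q v` of a matrix. -/
def matBil (Q : Matrix (Fin m) (Fin m) ℝ) (w v : Em m) : ℝ :=
  ∑ i, w i * Q.mulVec (fun j => v j) i

/-- The pair `(u(·), y(·))` generates the occupational measure `μ` on `[0,∞)`. -/
def GeneratesOM (u : ℝ → Dd d) (y : ℝ → Em m) (μ : Measure (Dd d × Em m)) : Prop :=
  IsProbabilityMeasure μ ∧ ∀ q : Dd d × Em m → ℝ, Continuous q →
    Tendsto (fun S : ℝ => S⁻¹ * ∫ τ in (0:ℝ)..S, q (u τ, y τ)) atTop (𝓝 (∫ p, q p ∂μ))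

/-- An average control generating (ACG) family `(u_z(·), y_z(·))` with occupational
measures `μ_z` and the (unique) solution `zsol` of `z'(t) = h̃(μ_{z(t)})`, `z 0 = z₀`. -/
def IsACG (U : Set (Dd d)) (f : Dd d → Em m → Em m) (F : Em m → Kk k)
    (g : Dd d → Em m → Em m) (Z : Set (Kk k)) (z₀ : Kk k)
    (uz : Kk k → ℝ → Dd d) (yz : Kk k → ℝ → Em m)
    (μz : Kk k → Measure (Dd d × Em m)) (zsol : ℝ → Kk k) : Prop :=
  (∀ z ∈ Z, IsControl U (uz z)) ∧
  (∀ z ∈ Z, IsSolOn (fun s x => f (uz z s) x) (yz z)) ∧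
  (∀ z ∈ Z, ∀ τ : ℝ, 0 ≤ τ → yz z τ ∈ lvl F z) ∧
  (∀ z ∈ Z, IsProbabilityMeasure (μz z)) ∧
  (∀ q : Dd d × Em m → ℝ, Continuous q →
    ∃ αq : ℝ → ℝ, Tendsto αq atTop (𝓝 0) ∧ ∀ z ∈ Z, ∀ S > (0:ℝ),
      |S⁻¹ * (∫ τ in (0:ℝ)..S, q (uz z τ, yz z τ)) - ∫ p, q p ∂(μz z)| ≤ αq S) ∧
  (∀ q : Dd d × Em m → ℝ, Continuous q → Measurable fun z => ∫ p, q p ∂(μz z)) ∧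
  zsol 0 = z₀ ∧ ContinuousOn zsol (Ici 0) ∧
  (∀ T : ℝ, IntervalIntegrable (fun s => htilde F g (μz (zsol s))) volume 0 T) ∧
  (∀ t : ℝ, 0 ≤ t → zsol t = z₀ + ∫ s in (0:ℝ)..t, htilde F g (μz (zsol s))) ∧
  (∀ t : ℝ, 0 ≤ t → zsol t ∈ Z) ∧
  (∀ w : ℝ → Kk k, w 0 = z₀ → ContinuousOn w (Ici 0) →
    (∀ T : ℝ, IntervalIntegrable (fun s => htilde F g (μz (w s))) volume 0 T) →
    (∀ t : ℝ, 0 ≤ t → w t = z₀ + ∫ s in (0:ℝ)..t, htilde F g (μz (w s))) →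
    (∀ t : ℝ, 0 ≤ t → w t ∈ Z) → ∀ t : ℝ, 0 ≤ t → w t = zsol t)

/-- Periodicity of an ACG family. -/
def ACGPeriodic (Z : Set (Kk k)) (uz : Kk k → ℝ → Dd d) (yz : Kk k → ℝ → Em m) : Prop :=
  ∀ z ∈ Z, ∃ T > (0:ℝ), ∀ τ : ℝ, 0 ≤ τ →
    uz z (τ + T) = uz z τ ∧ yz z (τ + T) = yz z τ

/-- Optimality of an ACG family in the averaged problem. -/
def ACGOptimal (U : Set (Dd d)) (f : Dd d → Em m → Em m) (F : Em m → Kk k)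
    (g : Dd d → Em m → Em m) (r : Dd d → Em m → ℝ) (C : ℝ) (z₀ : Kk k)
    (μz : Kk k → Measure (Dd d × Em m)) (zsol : ℝ → Kk k) : Prop :=
  (∫ t in Ioi (0:ℝ), Real.exp (-C * t) * rtilde r (μz (zsol t))) =
    RtildeStar U f F g r C z₀

/-- The set `D̃(z₀)` of discounted occupational measures supported on the graph of `W`. -/
def Dtilde (U : Set (Dd d)) (f : Dd d → Em m → Em m) (F : Em m → Kk k)
    (g : Dd d → Em m → Em m) (Z : Set (Kk k)) (C : ℝ) (z₀ : Kk k) :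
    Set (Measure (Measure (Dd d × Em m) × Kk k)) :=
  {p | IsProbabilityMeasure p ∧ p {q | q.2 ∈ Z ∧ q.1 ∈ W U f F q.2} = 1 ∧
    ∀ ψ : Kk k → ℝ, ContDiff ℝ 1 ψ →
      ∫ q, (fderiv ℝ ψ q.2 (htilde F g q.1) + C * (ψ z₀ - ψ q.2)) ∂p = 0}

/-- `ã^*(z₀)`: the optimal value of the IDLP problem. -/
def astar (U : Set (Dd d)) (f : Dd d → Em m → Em m) (F : Em m → Kk k)
    (g : Dd d → Em m → Em m) (r : Dd d → Em m → ℝ) (Z : Set (Kk k)) (C : ℝ)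
    (z₀ : Kk k) : ℝ :=
  sInf ((fun p => ∫ q, rtilde r q.1 ∂p) '' Dtilde U f F g Z C z₀)

/-- The Hamiltonian `H̃(p,z)` of the averaged system (`p` a linear functional). -/
def Htilde (U : Set (Dd d)) (f : Dd d → Em m → Em m) (F : Em m → Kk k)
    (g : Dd d → Em m → Em m) (r : Dd d → Em m → ℝ) (p : Kk k →L[ℝ] ℝ) (z : Kk k) : ℝ :=
  sInf ((fun μ => rtilde r μ + p (htilde F g μ)) '' W U f F z)

/-- Assumption V: existence of solutions `ζ*` of the averaged dual problem and `η*_z`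
of the associated dual problems. -/
def AssumptionV (U : Set (Dd d)) (f : Dd d → Em m → Em m) (F : Em m → Kk k)
    (g : Dd d → Em m → Em m) (r : Dd d → Em m → ℝ) (Z : Set (Kk k)) (C : ℝ)
    (z₀ : Kk k) (ζs : Kk k → ℝ) (ηs : Kk k → Em m → ℝ) : Prop :=
  ContDiff ℝ 1 ζs ∧ (∀ z, ContDiff ℝ 1 (ηs z)) ∧
  IsLeast ((fun z => Htilde U f F g r (fderiv ℝ ζs z) z + C * (ζs z₀ - ζs z)) '' Z)
    (astar U f F g r Z C z₀) ∧
  ∀ z ∈ Z, IsLeast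
    ((fun p : Dd d × Em m =>
        r p.1 p.2 + fderiv ℝ ζs z (hObs F g p) + fderiv ℝ (ηs z) p.2 (f p.1 p.2)) ''
      (U ×ˢ lvl F z))
    (Htilde U f F g r (fderiv ℝ ζs z) z)

/-- The occupational measure of a `T`-periodic orbit `y(·)` (a measure on the state space). -/
def perOcc (y : ℝ → Em m) (T : ℝ) : Measure (Em m) :=
  (ENNReal.ofReal T)⁻¹ • Measure.map y (volume.restrict (Ioc 0 T))

/-- Assumption III: for each `z ∈ Z`, the uncontrolled reduced system has a `T_z`-periodic
solution in `Y_z` (periods uniformly bounded), and every solution starting in `Y_z`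
is a time shift of it. -/
def AssumptionIII (f0 : Em m → Em m) (F : Em m → Kk k) (Z : Set (Kk k))
    (yper : Kk k → ℝ → Em m) (Tper : Kk k → ℝ) : Prop :=
  (∃ T₀ : ℝ, ∀ z ∈ Z, 0 < Tper z ∧ Tper z ≤ T₀) ∧
  (∀ z ∈ Z, IsSolOn (fun _ x => f0 x) (yper z)) ∧
  (∀ z ∈ Z, ∀ τ : ℝ, yper z τ ∈ lvl F z) ∧
  (∀ z ∈ Z, ∀ τ : ℝ, yper z (τ + Tper z) = yper z τ) ∧
  (∀ z ∈ Z, ∀ y : ℝ → Em m, IsSolOn (fun _ x => f0 x) y → y 0 ∈ lvl F z →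
    ∃ s : ℝ, ∀ τ : ℝ, 0 ≤ τ → y τ = yper z (τ + s))

/-- Assumption IV: existence, for each `z ∈ Z`, of a solution `ȳ_z` generating an
occupational measure `ν_z`, which asymptotically attracts (up to time shifts) every
solution staying in `Y_z`. -/
def AssumptionIV (f0 : Em m → Em m) (F : Em m → Kk k) (Z : Set (Kk k))
    (ybar : Kk k → ℝ → Em m) (ν : Kk k → Measure (Em m)) : Prop :=
  (∀ z ∈ Z, IsSolOn (fun _ x => f0 x) (ybar z)) ∧
  (∀ z ∈ Z, ∀ τ : ℝ, 0 ≤ τ → ybar z τ ∈ lvl F z) ∧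
  (∀ z ∈ Z, IsProbabilityMeasure (ν z) ∧ ν z (lvl F z) = 1) ∧
  (∀ q : Em m → ℝ, Continuous q → ∃ κ : ℝ → ℝ, Tendsto κ atTop (𝓝 0) ∧
    ∀ z ∈ Z, ∀ S > (0:ℝ),
      |S⁻¹ * (∫ τ in (0:ℝ)..S, q (ybar z τ)) - ∫ x, q x ∂(ν z)| ≤ κ S) ∧
  (∃ α₁ α₂ : ℝ → ℝ, Tendsto α₁ atTop (𝓝 0) ∧ Tendsto α₂ atTop (𝓝 0) ∧
    (∀ S > (0:ℝ), 0 < α₁ S ∧ 0 < α₂ S) ∧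
    ∀ z ∈ Z, ∀ y : ℝ → Em m, IsSolOn (fun _ x => f0 x) y →
      (∀ τ : ℝ, 0 ≤ τ → y τ ∈ lvl F z) → ∀ S > (0:ℝ),
        ∃ θ : ℝ, 0 ≤ θ ∧ θ / S ≤ α₂ S ∧
          ∀ τ ∈ Icc (0:ℝ) S, ‖y (τ + θ) - ybar z τ‖ ≤ α₁ S)

theorem norm_integral_le_mul_exp_div {E : Type*} [NormedAddCommGroup E] [NormedSpace ℝ E]
    {h : ℝ → E} {C a τ : ℝ} (hC : 0 ≤ C) (ha : 0 < a) (hτ : 0 ≤ τ)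
    (hh : ∀ s, 0 ≤ s → ‖h s‖ ≤ C * Real.exp (a * s)) :
    ‖∫ s in (0:ℝ)..τ, h s‖ ≤ C / a * Real.exp (a * τ) := by
  have h1 : ‖∫ s in (0:ℝ)..τ, h s‖ ≤ ∫ s in (0:ℝ)..τ, C * Real.exp (a * s) := by
    apply intervalIntegral.norm_integral_le_of_norm_le hτ
    · exact Eventually.of_forall fun s hs => hh s hs.1.le
    · exact (by fun_prop : Continuous fun s : ℝ => C * Real.exp (a * s)).intervalIntegrable _ _
  refine h1.trans ?_
  have h2 : ∫ s in (0:ℝ)..τ, C * Real.exp (a * s) =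
      C / a * Real.exp (a * τ) - C / a * Real.exp (a * 0) := by
    apply intervalIntegral.integral_eq_sub_of_hasDerivAt
    · intro s _
      have h3 : HasDerivAt (fun s : ℝ => a * s) a s := by
        simpa using (hasDerivAt_id s).const_mul a
      exact (h3.exp.const_mul (C / a)).congr_deriv (by field_simp)
    · exact (by fun_prop : Continuous fun s : ℝ => C * Real.exp (a * s)).intervalIntegrable _ _
  rw [h2]
  have : 0 ≤ C / a * Real.exp (a * 0) := by positivity
  linarith

/-- A globally Lipschitz autonomous system has a solution on `[0, ∞)` from every initial value. -/
theorem exists_global_solution {E : Type*} [NormedAddCommGroup E] [NormedSpace ℝ E]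
    [CompleteSpace E] {f : E → E} {K : ℝ≥0} (hf : LipschitzWith K f) (x : E) :
    ∃ y : ℝ → E, Continuous y ∧ ∀ t, 0 ≤ t → y t = x + ∫ s in (0:ℝ)..t, f (y s) := by
  set a : ℝ := K + 1 with ha_def
  have ha : 0 < a := by positivity
  let I : BoundedContinuousFunction ℝ E → ℝ → E := fun w t =>
    ∫ s in (0:ℝ)..t, f (Real.exp (a * s) • w s)
  have hcont (w : BoundedContinuousFunction ℝ E) :
      Continuous fun s : ℝ => f (Real.exp (a * s) • w s) :=
    hf.continuous.comp (by fun_prop)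
  have hI (w : BoundedContinuousFunction ℝ E) : Continuous (I w) :=
    intervalIntegral.continuous_primitive (fun _ _ => (hcont w).intervalIntegrable _ _) 0
  let P : BoundedContinuousFunction ℝ E → ℝ → E := fun w t =>
    Real.exp (-(a * max t 0)) • (x + I w (max t 0))
  have hPc (w : BoundedContinuousFunction ℝ E) : Continuous (P w) := by
    have : Continuous fun t : ℝ => I w (max t 0) := (hI w).comp (by fun_prop)
    fun_prop
  have hPb (w : BoundedContinuousFunction ℝ E) (t : ℝ) :
      ‖P w t‖ ≤ ‖x‖ + (‖f 0‖ + K * ‖w‖) / a := by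
    have hτ : 0 ≤ max t 0 := le_max_right _ _
    have h1 : ‖I w (max t 0)‖ ≤ (‖f 0‖ + K * ‖w‖) / a * Real.exp (a * max t 0) := by
      apply norm_integral_le_mul_exp_div (by positivity) ha hτ
      intro s hs
      have h2 : ‖f (Real.exp (a * s) • w s) - f 0‖ ≤ K * (Real.exp (a * s) * ‖w‖) := by
        refine (hf.norm_sub_le _ _).trans ?_
        rw [sub_zero, norm_smul, Real.norm_eq_abs, Real.abs_exp]
        gcongr
        exact w.norm_coe_le_norm s
      have h3 : 1 ≤ Real.exp (a * s) := Real.one_le_exp (by positivity)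
      calc ‖f (Real.exp (a * s) • w s)‖ ≤ ‖f 0‖ + ‖f (Real.exp (a * s) • w s) - f 0‖ := by
            simpa using norm_add_le (f 0) (f (Real.exp (a * s) • w s) - f 0)
        _ ≤ ‖f 0‖ * Real.exp (a * s) + K * (Real.exp (a * s) * ‖w‖) := by
            gcongr
            exact le_mul_of_one_le_right (norm_nonneg _) h3
        _ = _ := by ring
    have h4 : Real.exp (-(a * max t 0)) ≤ 1 := Real.exp_le_one_iff.2 (by
      have := mul_nonneg ha.le hτ; linarith)
    have h5 : Real.exp (-(a * max t 0)) * Real.exp (a * max t 0) = 1 := by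
      rw [← Real.exp_add]; simp
    calc ‖P w t‖ = Real.exp (-(a * max t 0)) * ‖x + I w (max t 0)‖ := by
          simp only [P, norm_smul, Real.norm_eq_abs, Real.abs_exp]
      _ ≤ Real.exp (-(a * max t 0)) *
          (‖x‖ + (‖f 0‖ + K * ‖w‖) / a * Real.exp (a * max t 0)) := by
          gcongr
          exact (norm_add_le _ _).trans (by gcongr)
      _ = Real.exp (-(a * max t 0)) * ‖x‖ + (‖f 0‖ + K * ‖w‖) / a *
          (Real.exp (-(a * max t 0)) * Real.exp (a * max t 0)) := by ring
      _ ≤ 1 * ‖x‖ + (‖f 0‖ + K * ‖w‖) / a * 1 := by rw [h5]; gcongr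
      _ = _ := by ring
  let S : BoundedContinuousFunction ℝ E → BoundedContinuousFunction ℝ E := fun w =>
    BoundedContinuousFunction.ofNormedAddCommGroup (P w) (hPc w) _ (hPb w)
  have hS : ContractingWith (K / (K + 1)) S := by
    refine ⟨?_, LipschitzWith.of_dist_le_mul fun w v => ?_⟩
    · rw [div_lt_one (by positivity)]
      exact lt_add_one K
    · rw [BoundedContinuousFunction.dist_le (by positivity)]
      intro t
      have hτ : 0 ≤ max t 0 := le_max_right _ _
      have h1 : ‖I w (max t 0) - I v (max t 0)‖ ≤
          (K * dist w v) / a * Real.exp (a * max t 0) := by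
        simp only [I]
        rw [← intervalIntegral.integral_sub ((hcont w).intervalIntegrable _ _)
          ((hcont v).intervalIntegrable _ _)]
        apply norm_integral_le_mul_exp_div (by positivity) ha hτ
        intro s _
        refine (hf.norm_sub_le _ _).trans ?_
        rw [← smul_sub, norm_smul, Real.norm_eq_abs, Real.abs_exp, ← dist_eq_norm]
        calc (K:ℝ) * (Real.exp (a * s) * dist (w s) (v s))
            ≤ K * (Real.exp (a * s) * dist w v) := by
              gcongr; exact BoundedContinuousFunction.dist_coe_le_dist s
          _ = _ := by ring
      have h5 : Real.exp (-(a * max t 0)) * Real.exp (a * max t 0) = 1 := by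
        rw [← Real.exp_add]; simp
      have h6 : dist (S w t) (S v t) =
          Real.exp (-(a * max t 0)) * ‖I w (max t 0) - I v (max t 0)‖ := by
        simp only [S, P, BoundedContinuousFunction.coe_ofNormedAddCommGroup, dist_eq_norm]
        rw [← smul_sub, add_sub_add_left_eq_sub, norm_smul, Real.norm_eq_abs, Real.abs_exp]
      rw [h6]
      calc Real.exp (-(a * max t 0)) * ‖I w (max t 0) - I v (max t 0)‖
          ≤ Real.exp (-(a * max t 0)) * ((K * dist w v) / a * Real.exp (a * max t 0)) := by
            gcongr
        _ = (K * dist w v) / a * (Real.exp (-(a * max t 0)) * Real.exp (a * max t 0)) := by ring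
        _ = _ := by rw [h5, ha_def]; push_cast; ring
  have hfix := hS.fixedPoint_isFixedPt
  set w := hS.fixedPoint
  refine ⟨fun t => Real.exp (a * t) • w t, by fun_prop, fun t ht => ?_⟩
  have h1 : w t = P w t := by
    conv_lhs => rw [← hfix]
    rfl
  have h2 : Real.exp (a * t) * Real.exp (-(a * t)) = 1 := by
    rw [← Real.exp_add]; simp
  simp only [h1, P, max_eq_left ht, smul_smul, h2, one_smul]
  rfl

theorem hasDerivWithinAt_of_integral_eq {E : Type*} [NormedAddCommGroup E] [NormedSpace ℝ E]
    [CompleteSpace E] {f : E → E} (hf : Continuous f) {y : ℝ → E}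
    (hy : ContinuousOn y (Ici 0)) (hyi : ∀ t, 0 ≤ t → y t = y 0 + ∫ s in (0:ℝ)..t, f (y s))
    {t : ℝ} (ht : 0 ≤ t) : HasDerivWithinAt y (f (y t)) (Ici t) t := by
  have hc : Continuous fun s : ℝ => f (y (max s 0)) :=
    hf.comp (hy.comp_continuous (by fun_prop) fun s => mem_Ici.2 (le_max_right _ _))
  have h1 : HasDerivAt (fun u : ℝ => y 0 + ∫ s in (0:ℝ)..u, f (y (max s 0))) (f (y (max t 0))) t :=
    (hc.integral_hasStrictDerivAt 0 t).hasDerivAt.const_add (y 0)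
  have h2 : ∀ u, 0 ≤ u → y u = y 0 + ∫ s in (0:ℝ)..u, f (y (max s 0)) := by
    intro u hu
    rw [hyi u hu]
    congr 1
    apply intervalIntegral.integral_congr
    intro s hs
    rw [uIcc_of_le hu] at hs
    simp only [max_eq_left hs.1]
  rw [max_eq_left ht] at h1
  exact h1.hasDerivWithinAt.congr (fun u hu => h2 u (ht.trans hu)) (h2 t ht)

/-- The forward flow of a globally Lipschitz autonomous vector field. -/
theorem exists_forward_flow {E : Type*} [NormedAddCommGroup E] [NormedSpace ℝ E]
    [CompleteSpace E] {f : E → E} {K : ℝ≥0} (hf : LipschitzWith K f) :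
    ∃ Φ : E → ℝ → E, (∀ x, Continuous (Φ x)) ∧ (∀ x, Φ x 0 = x) ∧
      (∀ x t, 0 ≤ t → Φ x t = x + ∫ s in (0:ℝ)..t, f (Φ x s)) ∧
      (∀ x t, 0 ≤ t → HasDerivWithinAt (Φ x) (f (Φ x t)) (Ici t) t) ∧
      (∀ x y t, 0 ≤ t → dist (Φ x t) (Φ y t) ≤ Real.exp (K * t) * dist x y) ∧
      (∀ x s t, 0 ≤ s → 0 ≤ t → Φ (Φ x s) t = Φ x (t + s)) := by
  choose Φ hc hi using exists_global_solution hf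
  have h0 : ∀ x, Φ x 0 = x := fun x => by simpa using hi x 0 le_rfl
  have hd : ∀ x t, 0 ≤ t → HasDerivWithinAt (Φ x) (f (Φ x t)) (Ici t) t := fun x t ht =>
    hasDerivWithinAt_of_integral_eq hf.continuous (hc x).continuousOn
      (fun t ht => by rw [h0]; exact hi x t ht) ht
  refine ⟨Φ, hc, h0, hi, hd, fun x y t ht => ?_, fun x s t hs ht => ?_⟩
  · have := dist_le_of_trajectories_ODE (v := fun _ => f) (K := K) (fun _ => hf)
      (hc x).continuousOn (a := 0) (b := t) (fun u hu => hd x u hu.1) (hc y).continuousOn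
      (fun u hu => hd y u hu.1) (δ := dist x y) (by rw [h0, h0]) t ⟨ht, le_rfl⟩
    rw [sub_zero] at this
    linarith
  · refine ODE_solution_unique (v := fun _ => f) (K := K) (f := Φ (Φ x s))
      (g := fun u => Φ x (u + s)) (fun _ => hf) (hc _).continuousOn (a := 0) (b := t)
      (fun u hu => hd _ u hu.1) ((hc x).comp (by fun_prop)).continuousOn (fun u hu => ?_)
      (by simp [h0]) ⟨ht, le_rfl⟩
    have h1 := hd x (u + s) (add_nonneg hu.1 hs)
    have h2 : HasDerivWithinAt (fun u : ℝ => u + s) 1 (Ici u) u :=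
      (hasDerivWithinAt_id u _).add_const s
    have h3 := HasDerivWithinAt.scomp u h1 h2 (fun v hv => by
      simp only [mem_Ici] at hv ⊢; linarith)
    simpa [Function.comp_def] using h3

theorem integrable_of_continuousOn_of_isCompact {X E : Type*} [MeasurableSpace X]
    [TopologicalSpace X] [T2Space X] [OpensMeasurableSpace X] [NormedAddCommGroup E]
    {μ : Measure X} [IsFiniteMeasure μ] {S : Set X} {q : X → E} (hS : IsCompact S)
    (hμ : ∀ᵐ x ∂μ, x ∈ S) (hq : ContinuousOn q S) : Integrable q μ := by
  have h := hq.integrableOn_compact (μ := μ) hS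
  rwa [IntegrableOn, Measure.restrict_eq_self_of_ae_mem hμ] at h

theorem tendsto_slope_of_hasDerivWithinAt_Ici {p : ℝ → ℝ} {p' : ℝ}
    (h : HasDerivWithinAt p p' (Ici 0) 0) {s : ℕ → ℝ} (hs : ∀ n, 0 < s n)
    (hs0 : Tendsto s atTop (𝓝 0)) :
    Tendsto (fun n => (s n)⁻¹ * (p (s n) - p 0)) atTop (𝓝 p') := by
  have h1 := (hasDerivWithinAt_iff_tendsto_slope' (by simp)).1
    (h.mono (Ioi_subset_Ici_self : Ioi (0:ℝ) ⊆ Ici 0))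
  have h2 : Tendsto s atTop (𝓝[>] 0) :=
    tendsto_nhdsWithin_of_tendsto_nhds_of_eventually_within _ hs0 (Eventually.of_forall hs)
  simpa [Function.comp_def, slope, vsub_eq_sub, sub_zero, smul_eq_mul] using h1.comp h2

/-- Commutator estimate: mollifying a Lipschitz function almost commutes with differentiation
along a Lipschitz vector field. -/
theorem abs_fderiv_convolution_sub_le {f : Em m → Em m} {K : ℝ≥0} (hf : LipschitzWith K f)
    {G A : Em m → ℝ} {C : ℝ≥0} (hG : LipschitzWith C G)
    (hder : ∀ x, HasDerivWithinAt (fun s : ℝ => G (x + s • f x)) (A x) (Ici 0) 0)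
    (η : ContDiffBump (0 : Em m)) (x : Em m) :
    |fderiv ℝ (convolution (η.normed volume) G (ContinuousLinearMap.lsmul ℝ ℝ) volume) x (f x) -
      convolution (η.normed volume) A (ContinuousLinearMap.lsmul ℝ ℝ) volume x|
      ≤ C * K * η.rOut := by
  set w := η.normed (volume : Measure (Em m)) with hw
  set φ := convolution w G (ContinuousLinearMap.lsmul ℝ ℝ) volume with hφ
  have hwc : Continuous w := η.continuous_normed
  have hws : HasCompactSupport w := η.hasCompactSupport_normed
  have hw0 : ∀ y, 0 ≤ w y := η.nonneg_normed
  have hint (H : Em m → ℝ) (hH : Continuous H) : Integrable (fun y => w y * H y) :=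
    (hwc.mul hH).integrable_of_hasCompactSupport hws.mul_right
  have hφC : ContDiff ℝ 1 φ := by
    exact_mod_cast hws.contDiff_convolution_left (n := 1) _ (η.contDiff_normed)
      hG.continuous.locallyIntegrable
  have hφv : ∀ y, φ y = ∫ t, w t * G (y - t) := fun y => by
    simp [hφ, convolution, ContinuousLinearMap.lsmul_apply]
  have hAv : convolution w A (ContinuousLinearMap.lsmul ℝ ℝ) volume x = ∫ t, w t * A (x - t) := by
    simp [convolution, ContinuousLinearMap.lsmul_apply]
  set s : ℕ → ℝ := fun n => 1 / ((n:ℝ) + 1) with hs_def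
  have hs : ∀ n, 0 < s n := fun n => by positivity
  have hs0 : Tendsto s atTop (𝓝 0) := tendsto_one_div_add_atTop_nhds_zero_nat
  have hlim1 : Tendsto (fun n => (s n)⁻¹ * (φ (x + s n • f x) - φ x)) atTop
      (𝓝 (fderiv ℝ φ x (f x))) := by
    have h1 : HasDerivAt (fun t : ℝ => φ (x + t • f x)) (fderiv ℝ φ x (f x)) 0 := by
      have h2 : HasDerivAt (fun t : ℝ => x + t • f x) (f x) 0 := by
        simpa using ((hasDerivAt_id (0:ℝ)).smul_const (f x)).const_add x
      have h3 : HasFDerivAt φ (fderiv ℝ φ x) (x + (0:ℝ) • f x) := by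
        simpa using (hφC.differentiable (by norm_num) x).hasFDerivAt
      exact h3.comp_hasDerivAt (0:ℝ) h2
    simpa using tendsto_slope_of_hasDerivWithinAt_Ici h1.hasDerivWithinAt hs hs0
  have hlim2 : Tendsto (fun n => ∫ t, w t * ((s n)⁻¹ * (G (x - t + s n • f (x - t)) - G (x - t))))
      atTop (𝓝 (∫ t, w t * A (x - t))) := by
    apply tendsto_integral_of_dominated_convergence (fun t => w t * (C * ‖f (x - t)‖))
    · intro n
      have := hG.continuous
      have := hf.continuous
      exact (by fun_prop : Continuous _).aestronglyMeasurable
    · have := hf.continuous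
      exact hint _ (by fun_prop)
    · intro n
      refine Eventually.of_forall fun t => ?_
      rw [norm_mul, Real.norm_of_nonneg (hw0 t)]
      refine mul_le_mul_of_nonneg_left ?_ (hw0 t)
      rw [norm_mul, norm_inv, Real.norm_of_nonneg (hs n).le, inv_mul_le_iff₀ (hs n)]
      refine (hG.norm_sub_le _ _).trans (le_of_eq ?_)
      rw [add_sub_cancel_left, norm_smul, Real.norm_of_nonneg (hs n).le]
      ring
    · refine Eventually.of_forall fun t => Tendsto.const_mul _ ?_
      simpa using tendsto_slope_of_hasDerivWithinAt_Ici (hder (x - t)) hs hs0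
  rw [hAv]
  refine le_of_tendsto (hlim1.sub hlim2).abs (Eventually.of_forall fun n => ?_)
  have hGc := hG.continuous
  have hfc := hf.continuous
  have e1 : (s n)⁻¹ * (φ (x + s n • f x) - φ x) =
      ∫ t, w t * ((s n)⁻¹ * (G (x + s n • f x - t) - G (x - t))) := by
    rw [hφv, hφv, ← integral_sub (hint _ (by fun_prop)) (hint _ (by fun_prop)),
      ← integral_const_mul]
    congr 1; ext t; ring
  rw [e1, ← integral_sub (hint _ (by fun_prop)) (hint _ (by fun_prop)), ← Real.norm_eq_abs]
  have e2 : (C * K * η.rOut : ℝ) = ∫ t, w t * (C * K * η.rOut) := by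
    rw [integral_mul_const, hw, η.integral_normed, one_mul]
  rw [e2]
  refine norm_integral_le_of_norm_le (hint _ continuous_const) (Eventually.of_forall fun t => ?_)
  rw [← mul_sub, norm_mul, Real.norm_of_nonneg (hw0 t)]
  by_cases ht : w t = 0
  · simp [ht]
  have ht' : ‖t‖ < η.rOut := by
    have : t ∈ Function.support w := ht
    rw [hw, η.support_normed_eq] at this
    simpa using this
  refine mul_le_mul_of_nonneg_left ?_ (hw0 t)
  rw [← mul_sub, norm_mul, norm_inv, Real.norm_of_nonneg (hs n).le, inv_mul_le_iff₀ (hs n),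
    sub_sub_sub_cancel_right]
  refine (hG.norm_sub_le _ _).trans ?_
  have e3 : x + s n • f x - t - (x - t + s n • f (x - t)) = s n • (f x - f (x - t)) := by
    rw [smul_sub]; abel
  rw [e3, norm_smul, Real.norm_of_nonneg (hs n).le]
  have e4 : ‖f x - f (x - t)‖ ≤ K * ‖t‖ := by simpa using hf.norm_sub_le x (x - t)
  calc (C:ℝ) * (s n * ‖f x - f (x - t)‖) ≤ C * (s n * (K * η.rOut)) := by
        have := (hs n).le
        gcongr
        exact e4.trans (by gcongr)
    _ = _ := by ring

/-- A measure annihilating the derivatives of `C¹` functions along a Lipschitz vector field also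
annihilates continuous derivatives of merely Lipschitz functions. -/
theorem integral_eq_zero_of_forall_contDiff {f : Em m → Em m} {K : ℝ≥0} (hf : LipschitzWith K f)
    {G A : Em m → ℝ} {C : ℝ≥0} (hG : LipschitzWith C G) (hA : Continuous A)
    (hder : ∀ x, HasDerivWithinAt (fun s : ℝ => G (x + s • f x)) (A x) (Ici 0) 0)
    {ν : Measure (Em m)} [IsFiniteMeasure ν] {S : Set (Em m)} (hS : IsCompact S)
    (hν : ∀ᵐ x ∂ν, x ∈ S)
    (h : ∀ φ : Em m → ℝ, ContDiff ℝ 1 φ → ∫ x, fderiv ℝ φ x (f x) ∂ν = 0) :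
    ∫ x, A x ∂ν = 0 := by
  have key : ∀ δ > (0:ℝ), |∫ x, A x ∂ν| ≤ (C * K * δ + δ) * ν.real univ := by
    intro δ hδ
    have hu := hS.uniformContinuousAt_of_continuousAt A (fun a _ => hA.continuousAt)
      (Metric.dist_mem_uniformity hδ)
    obtain ⟨ε, hε, hεs⟩ := Metric.mem_uniformity_dist.1 hu
    let η : ContDiffBump (0 : Em m) := ⟨min ε δ / 2, min ε δ, by positivity,
      half_lt_self (by positivity)⟩
    set φ := convolution (η.normed volume) G (ContinuousLinearMap.lsmul ℝ ℝ) volume with hφ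
    have hφC : ContDiff ℝ 1 φ := by
      exact_mod_cast η.hasCompactSupport_normed.contDiff_convolution_left (n := 1) _
        (η.contDiff_normed) hG.continuous.locallyIntegrable
    have hφc : Continuous fun x => fderiv ℝ φ x (f x) :=
      (hφC.continuous_fderiv (by norm_num)).clm_apply hf.continuous
    have e1 : ∫ x, A x ∂ν = ∫ x, (A x - fderiv ℝ φ x (f x)) ∂ν := by
      rw [integral_sub (integrable_of_continuousOn_of_isCompact hS hν hA.continuousOn)
        (integrable_of_continuousOn_of_isCompact hS hν hφc.continuousOn), h φ hφC, sub_zero]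
    rw [e1, ← Real.norm_eq_abs]
    apply norm_integral_le_of_norm_le_const
    filter_upwards [hν] with x hx
    have h1 := abs_fderiv_convolution_sub_le hf hG hder η x
    have h2 : dist (convolution (η.normed volume) A (ContinuousLinearMap.lsmul ℝ ℝ) volume x) (A x)
        ≤ δ := by
      apply ContDiffBump.dist_normed_convolution_le hA.aestronglyMeasurable
      intro y hy
      have hy' : dist x y < ε := by
        rw [dist_comm]
        exact (mem_ball.1 hy).trans_le (min_le_left _ _)
      rw [dist_comm]
      exact le_of_lt (hεs hy' hx)
    have h3 : (C * K * η.rOut : ℝ) ≤ C * K * δ := by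
      gcongr
      exact min_le_right _ _
    rw [Real.dist_eq] at h2
    rw [Real.norm_eq_abs]
    have h4 := abs_le.1 h1
    have h5 := abs_le.1 h2
    rw [abs_le]
    constructor <;> linarith [h4.1, h4.2, h5.1, h5.2]
  have hlim : Tendsto (fun δ : ℝ => (C * K * δ + δ) * ν.real univ) (𝓝[>] 0) (𝓝 0) := by
    have : Continuous fun δ : ℝ => (C * K * δ + δ) * ν.real univ := by fun_prop
    simpa using (this.tendsto 0).mono_left nhdsWithin_le_nhds
  have := ge_of_tendsto hlim (eventually_nhdsWithin_of_forall key)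
  exact abs_nonpos_iff.1 this

theorem lipschitzWith_intervalIntegral {E : Type*} [NormedAddCommGroup E] {Ψ : E → ℝ → ℝ}
    (hΨ : ∀ x, Continuous (Ψ x)) {B : ℝ≥0} {T : ℝ} (hT : 0 ≤ T)
    (hB : ∀ x y t, t ∈ Icc 0 T → |Ψ x t - Ψ y t| ≤ B * dist x y) :
    LipschitzWith (B * T.toNNReal) fun x => ∫ t in (0:ℝ)..T, Ψ x t := by
  refine LipschitzWith.of_dist_le_mul fun x y => ?_
  rw [dist_eq_norm, ← intervalIntegral.integral_sub ((hΨ x).intervalIntegrable _ _)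
    ((hΨ y).intervalIntegrable _ _)]
  refine (intervalIntegral.norm_integral_le_of_norm_le_const (C := B * dist x y)
    fun t ht => ?_).trans (le_of_eq ?_)
  · rw [uIoc_of_le hT] at ht
    exact hB x y t ⟨ht.1.le, ht.2⟩
  · rw [sub_zero, abs_of_nonneg hT]
    push_cast
    rw [Real.coe_toNNReal _ hT]
    ring

theorem hasDerivAt_weighted_average {p : ℝ → ℝ} (hp : Continuous p) {T : ℝ} (hT : 0 < T) :
    HasDerivAt (fun s => T⁻¹ * ∫ t in (0:ℝ)..T, t * p (t + s))
      (p T - T⁻¹ * ∫ t in (0:ℝ)..T, p t) 0 := by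
  have hp' : Continuous fun t => t * p t := by fun_prop
  set P : ℝ → ℝ := fun u => ∫ t in (0:ℝ)..u, p t with hP
  set M : ℝ → ℝ := fun u => ∫ t in (0:ℝ)..u, t * p t with hM
  have hPd : ∀ u, HasDerivAt P (p u) u := fun u => (hp.integral_hasStrictDerivAt 0 u).hasDerivAt
  have hMd : ∀ u, HasDerivAt M (u * p u) u := fun u =>
    (hp'.integral_hasStrictDerivAt 0 u).hasDerivAt
  have e : (fun s => T⁻¹ * ∫ t in (0:ℝ)..T, t * p (t + s)) =
      fun s => T⁻¹ * ((M (T + s) - M s) - s * (P (T + s) - P s)) := by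
    ext s
    have h1 : ∫ t in (0:ℝ)..T, t * p (t + s) = ∫ t in (0 + s)..(T + s), (t - s) * p t := by
      rw [← intervalIntegral.integral_comp_add_right (fun u => (u - s) * p u)]
      simp
    have h2 : ∀ a b, ∫ t in a..b, (t - s) * p t =
        (∫ t in a..b, t * p t) - s * ∫ t in a..b, p t := by
      intro a b
      rw [← intervalIntegral.integral_const_mul, ← intervalIntegral.integral_sub
        (hp'.intervalIntegrable _ _) ((by fun_prop : Continuous _).intervalIntegrable _ _)]
      congr 1; ext t; ring
    rw [h1, h2, zero_add, hM, hP]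
    simp only
    rw [intervalIntegral.integral_interval_sub_left (hp'.intervalIntegrable _ _)
      (hp'.intervalIntegrable _ _), intervalIntegral.integral_interval_sub_left
      (hp.intervalIntegrable _ _) (hp.intervalIntegrable _ _)]
  rw [e]
  have hs : HasDerivAt (fun s : ℝ => T + s) 1 0 := (hasDerivAt_id (0:ℝ)).const_add T
  have hM1 : HasDerivAt (fun s => M (T + s)) ((T + 0) * p (T + 0) * 1) 0 :=
    (hMd (T + 0)).comp (0:ℝ) hs
  have hP1 : HasDerivAt (fun s => P (T + s)) (p (T + 0) * 1) 0 := (hPd (T + 0)).comp (0:ℝ) hs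
  have := ((hM1.sub (hMd 0)).sub ((hasDerivAt_id (0:ℝ)).mul (hP1.sub (hPd 0)))).const_mul T⁻¹
  refine this.congr_deriv ?_
  have hP0 : P 0 = 0 := by simp [hP]
  change _ = p T - T⁻¹ * P T
  simp only [id, add_zero, Pi.sub_apply, hP0]
  field_simp
  ring

theorem HasDerivWithinAt.of_lipschitz_of_tangent {E : Type*} [NormedAddCommGroup E]
    [NormedSpace ℝ E] {G : E → ℝ} {C : ℝ≥0} (hG : LipschitzWith C G) {c : ℝ → E} {v : E} {a : ℝ}
    (hc : HasDerivWithinAt c v (Ici 0) 0)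
    (hGc : HasDerivWithinAt (fun s => G (c s)) a (Ici 0) 0) :
    HasDerivWithinAt (fun s : ℝ => G (c 0 + s • v)) a (Ici 0) 0 := by
  have h1 : HasDerivWithinAt (fun s : ℝ => G (c 0 + s • v) - G (c s)) 0 (Ici 0) 0 := by
    rw [hasDerivWithinAt_iff_isLittleO] at hc ⊢
    refine Asymptotics.IsBigO.trans_isLittleO ?_ hc
    refine Asymptotics.IsBigO.of_bound C (Eventually.of_forall fun s => ?_)
    simp only [zero_smul, add_zero, sub_self, sub_zero, smul_zero]
    refine (hG.norm_sub_le _ _).trans (le_of_eq ?_)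
    rw [← norm_neg]
    congr 2
    abel
  have h2 := h1.add hGc
  rw [zero_add] at h2
  exact h2.congr (fun s _ => by simp) (by simp)

/-- `y` is a `T`-periodic orbit of `y' = f y` in `S`, and every solution starting in `S` is a time
shift of it. -/
structure IsUniquePeriodicOrbit (f : Em m → Em m) (S : Set (Em m)) (y : ℝ → Em m) (T : ℝ) :
    Prop where
  pos : 0 < T
  sol : IsSolOn (fun _ x => f x) y
  mem : ∀ τ, y τ ∈ S
  per : ∀ τ, y (τ + T) = y τ
  uniq : ∀ w : ℝ → Em m, IsSolOn (fun _ x => f x) w → w 0 ∈ S →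
    ∃ s : ℝ, ∀ τ : ℝ, 0 ≤ τ → w τ = y (τ + s)

theorem IsUniquePeriodicOrbit.aemeasurable {f : Em m → Em m} {S : Set (Em m)} {y : ℝ → Em m}
    {T : ℝ} (h : IsUniquePeriodicOrbit f S y T) :
    AEMeasurable y (volume.restrict (Ioc 0 T)) :=
  (h.sol.1.mono fun _ ht => ht.1.le).aemeasurable measurableSet_Ioc

theorem IsUniquePeriodicOrbit.isProbabilityMeasure {f : Em m → Em m} {S : Set (Em m)}
    {y : ℝ → Em m} {T : ℝ} (h : IsUniquePeriodicOrbit f S y T) :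
    IsProbabilityMeasure (perOcc y T) := by
  constructor
  have hT : ENNReal.ofReal T ≠ 0 := by simpa using h.pos
  rw [perOcc, Measure.smul_apply, Measure.map_apply_of_aemeasurable h.aemeasurable .univ]
  simp [ENNReal.inv_mul_cancel hT ENNReal.ofReal_ne_top]

theorem IsUniquePeriodicOrbit.ae_mem {f : Em m → Em m} {S : Set (Em m)} (hS : MeasurableSet S)
    {y : ℝ → Em m} {T : ℝ} (h : IsUniquePeriodicOrbit f S y T) : ∀ᵐ x ∂(perOcc y T), x ∈ S := by
  refine Measure.ae_smul_measure ?_ _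
  exact (ae_map_iff h.aemeasurable hS).2 (Eventually.of_forall h.mem)

theorem IsUniquePeriodicOrbit.integral_perOcc {f : Em m → Em m} {S : Set (Em m)}
    {y : ℝ → Em m} {T : ℝ} (h : IsUniquePeriodicOrbit f S y T) {q : Em m → ℝ}
    (hq : Continuous q) : ∫ x, q x ∂(perOcc y T) = T⁻¹ * ∫ t in (0:ℝ)..T, q (y t) := by
  rw [perOcc, integral_smul_measure, integral_map h.aemeasurable hq.aestronglyMeasurable,
    intervalIntegral.integral_of_le h.pos.le, ENNReal.toReal_inv, ENNReal.toReal_ofReal h.pos.le,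
    smul_eq_mul]

theorem IsUniquePeriodicOrbit.integral_fderiv_perOcc {f : Em m → Em m} (hf : Continuous f)
    {S : Set (Em m)} {y : ℝ → Em m} {T : ℝ} (h : IsUniquePeriodicOrbit f S y T) {φ : Em m → ℝ}
    (hφ : ContDiff ℝ 1 φ) : ∫ x, fderiv ℝ φ x (f x) ∂(perOcc y T) = 0 := by
  have hc : Continuous fun x => fderiv ℝ φ x (f x) :=
    (hφ.continuous_fderiv (by norm_num)).clm_apply hf
  have hy : ContinuousOn y (uIcc 0 T) := h.sol.1.mono (by
    rw [uIcc_of_le h.pos.le]; exact fun _ ht => ht.1)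
  have e : ∫ t in (0:ℝ)..T, fderiv ℝ φ (y t) (f (y t)) = φ (y T) - φ (y 0) := by
    refine intervalIntegral.integral_eq_sub_of_hasDeriv_right
      (f := fun t => φ (y t)) (hφ.continuous.comp_continuousOn hy) (fun t ht => ?_)
      (hc.comp_continuousOn hy).intervalIntegrable
    rw [min_eq_left h.pos.le, max_eq_right h.pos.le] at ht
    have h1 := hasDerivWithinAt_of_integral_eq hf h.sol.1 h.sol.2.2 ht.1.le
    exact ((hφ.differentiable (by norm_num) (y t)).hasFDerivAt.comp_hasDerivWithinAt t h1).mono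
      Ioi_subset_Ici_self
  have hp := h.per 0
  rw [zero_add] at hp
  rw [h.integral_perOcc hc, e, hp, sub_self, mul_zero]

/-- The occupational measure of the orbit is the only stationary probability measure on `S`. -/
theorem IsUniquePeriodicOrbit.eq_perOcc {f : Em m → Em m} {K : ℝ≥0} (hf : LipschitzWith K f)
    {S : Set (Em m)} (hS : IsCompact S) {y : ℝ → Em m} {T : ℝ}
    (h : IsUniquePeriodicOrbit f S y T) {ν : Measure (Em m)} [IsProbabilityMeasure ν]
    (hν : ∀ᵐ x ∂ν, x ∈ S)
    (hst : ∀ φ : Em m → ℝ, ContDiff ℝ 1 φ → ∫ x, fderiv ℝ φ x (f x) ∂ν = 0) :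
    ν = perOcc y T := by
  have := h.isProbabilityMeasure
  have hT := h.pos
  obtain ⟨Φ, hΦc, hΦ0, hΦi, hΦd, hΦl, hΦs⟩ := exists_forward_flow hf
  have key : ∀ q : Em m → ℝ, (∃ C, LipschitzWith C q) →
      ∫ x, q x ∂ν = ∫ x, q x ∂(perOcc y T) := by
    rintro q ⟨C, hq⟩
    have hqc := hq.continuous
    have hqΦ : ∀ x y t, t ∈ Icc 0 T → |q (Φ x t) - q (Φ y t)| ≤
        (C * (Real.exp (K * T)).toNNReal : ℝ≥0) * dist x y := by
      intro x y t ht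
      rw [← Real.dist_eq]
      refine (hq.dist_le_mul _ _).trans ?_
      push_cast
      rw [Real.coe_toNNReal _ (Real.exp_nonneg _), mul_assoc]
      gcongr
      refine (hΦl x y t ht.1).trans ?_
      gcongr
      exact ht.2
    have hG : LipschitzWith (‖T⁻¹‖₊ * (T.toNNReal * (C * (Real.exp (K * T)).toNNReal) *
        T.toNNReal)) fun x => T⁻¹ * ∫ t in (0:ℝ)..T, t * q (Φ x t) := by
      refine (lipschitzWith_smul T⁻¹).comp (lipschitzWith_intervalIntegral (fun x => by
        have := hΦc x; fun_prop) hT.le fun x y t ht => ?_)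
      rw [← mul_sub, abs_mul, abs_of_nonneg ht.1, NNReal.coe_mul, Real.coe_toNNReal _ hT.le,
        mul_assoc]
      exact mul_le_mul ht.2 (hqΦ x y t ht) (abs_nonneg _) hT.le
    have hA : Continuous fun x => q (Φ x T) - T⁻¹ * ∫ t in (0:ℝ)..T, q (Φ x t) := by
      refine Continuous.sub ?_ (continuous_const.mul (lipschitzWith_intervalIntegral (fun x =>
        hqc.comp (hΦc x)) hT.le hqΦ).continuous)
      exact (LipschitzWith.of_dist_le_mul fun x y => hqΦ x y T ⟨hT.le, le_rfl⟩).continuous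
    have h0 := integral_eq_zero_of_forall_contDiff hf hG hA (fun x => by
      have h1 : HasDerivWithinAt (Φ x) (f x) (Ici 0) 0 := by
        simpa [hΦ0] using hΦd x 0 le_rfl
      have h2 := (hasDerivAt_weighted_average (hqc.comp (hΦc x)) hT).hasDerivWithinAt (s := Ici 0)
      have h3 := HasDerivWithinAt.of_lipschitz_of_tangent hG h1
        (h2.congr (fun s hs => ?_) ?_)
      · simpa only [hΦ0, Function.comp] using h3
      · congr 1
        apply intervalIntegral.integral_congr
        intro t ht
        rw [uIcc_of_le hT.le] at ht
        simp only [hΦs x s t hs ht.1, Function.comp]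
      · congr 1
        apply intervalIntegral.integral_congr
        intro t ht
        rw [uIcc_of_le hT.le] at ht
        simp only [hΦs x 0 t le_rfl ht.1, Function.comp]) hS hν hst
    have hper : Function.Periodic (fun t => q (y t)) T := fun t => by simp only [h.per]
    have h1 : ∀ x ∈ S, q (Φ x T) - T⁻¹ * ∫ t in (0:ℝ)..T, q (Φ x t) =
        q x - ∫ x, q x ∂(perOcc y T) := by
      intro x hx
      obtain ⟨s, hs⟩ := h.uniq (Φ x) ⟨(hΦc x).continuousOn, fun t =>
        (hf.continuous.comp (hΦc x)).intervalIntegrable _ _, fun t ht => by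
          rw [hΦ0]; exact hΦi x t ht⟩ (by rwa [hΦ0])
      have e1 : Φ x T = x := by
        rw [hs T hT.le, add_comm, h.per, ← zero_add s, ← hs 0 le_rfl, hΦ0]
      have e2 : ∫ t in (0:ℝ)..T, q (Φ x t) = ∫ t in (0:ℝ)..T, q (y t) := by
        have e3 : ∫ t in (0:ℝ)..T, q (Φ x t) = ∫ t in (0:ℝ)..T, q (y (t + s)) := by
          apply intervalIntegral.integral_congr
          intro t ht
          rw [uIcc_of_le hT.le] at ht
          simp only [hs t ht.1]
        rw [e3, intervalIntegral.integral_comp_add_right (fun t => q (y t)), add_comm T s,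
          zero_add]
        simpa using hper.intervalIntegral_add_eq s 0
      rw [e1, e2, h.integral_perOcc hqc]
    have h2 : ∫ x, (q x - ∫ x, q x ∂(perOcc y T)) ∂ν = 0 := by
      rw [← h0]
      apply integral_congr_ae
      filter_upwards [hν] with x hx using (h1 x hx).symm
    rw [integral_sub (integrable_of_continuousOn_of_isCompact hS hν hqc.continuousOn)
      (integrable_const _), integral_const, probReal_univ, one_smul, sub_eq_zero] at h2
    exact h2
  let P : ProbabilityMeasure (Em m) := ⟨ν, inferInstance⟩
  let Q : ProbabilityMeasure (Em m) := ⟨perOcc y T, inferInstance⟩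
  have hPQ : Tendsto (fun _ : ℕ => P) atTop (𝓝 Q) := by
    rw [tendsto_iff_forall_lipschitz_integral_tendsto]
    intro q _ hq
    simp only [P, Q, ProbabilityMeasure.coe_mk, key q hq]
    exact tendsto_const_nhds
  have hE : P = Q := tendsto_nhds_unique tendsto_const_nhds hPQ
  exact congrArg Subtype.val hE

theorem exists_fine_partition {B : Type*} [PseudoMetricSpace B] {Y : Set B} (hY : IsCompact Y)
    {δ : ℝ} (hδ : 0 < δ) : ∃ (t : Finset B) (χ : B → B → ℝ), (∀ i, Continuous (χ i)) ∧
      (∀ i y, 0 ≤ χ i y) ∧ (∀ i y, χ i y ≠ 0 → dist y i < δ) ∧ ∀ y ∈ Y, ∑ i ∈ t, χ i y = 1 := by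
  obtain ⟨t, -, ht, htY⟩ := hY.finite_cover_balls (half_pos hδ)
  lift t to Finset B using ht
  set ψ : B → B → ℝ := fun i y => max 0 (δ - dist y i) with hψ
  have hψ0 : ∀ i y, 0 ≤ ψ i y := fun i y => le_max_left _ _
  have hψc : ∀ i, Continuous (ψ i) := fun i => by simp only [hψ]; fun_prop
  set s : B → ℝ := fun y => max (δ / 2) (∑ i ∈ t, ψ i y) with hs
  have hs0 : ∀ y, 0 < s y := fun y => (half_pos hδ).trans_le (le_max_left _ _)
  have hsc : Continuous s := by simp only [hs]; fun_prop
  refine ⟨t, fun i y => ψ i y / s y, fun i => (hψc i).div hsc fun y => (hs0 y).ne',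
    fun i y => div_nonneg (hψ0 i y) (hs0 y).le, fun i y h => ?_, fun y hy => ?_⟩
  · by_contra! hle
    exact h (by simp [hψ, max_eq_left (sub_nonpos.2 hle)])
  · rw [← Finset.sum_div]
    have h1 : δ / 2 ≤ ∑ i ∈ t, ψ i y := by
      obtain ⟨i, hi, hyi⟩ := mem_iUnion₂.1 (htY hy)
      have h2 : ψ i y ≤ ∑ i ∈ t, ψ i y :=
        Finset.single_le_sum (f := fun i => ψ i y) (fun i _ => hψ0 i y) hi
      have h3 : δ - dist y i ≤ ψ i y := le_max_right _ _
      have h4 := mem_ball.1 hyi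
      linarith
    have h2 : s y = ∑ i ∈ t, ψ i y := max_eq_right h1
    rw [← h2, div_self (hs0 y).ne']

/-- Measures on `U × ℝ^m` whose second marginal is `ν`. -/
def lifts (U : Set (Dd d)) (ν : Measure (Em m)) : Set (Measure (Dd d × Em m)) :=
  {μ | (∀ᵐ p ∂μ, p.1 ∈ U) ∧ μ.snd = ν}

theorem isProbabilityMeasure_of_mem_lifts {U : Set (Dd d)} {ν : Measure (Em m)}
    [IsProbabilityMeasure ν] {μ : Measure (Dd d × Em m)} (hμ : μ ∈ lifts U ν) :
    IsProbabilityMeasure μ := by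
  constructor
  rw [← Measure.snd_univ, hμ.2, measure_univ]

theorem ae_snd_of_mem_lifts {U : Set (Dd d)} {ν : Measure (Em m)} {μ : Measure (Dd d × Em m)}
    (hμ : μ ∈ lifts U ν) {P : Em m → Prop} (hP : ∀ᵐ y ∂ν, P y) : ∀ᵐ p ∂μ, P p.2 := by
  rw [← hμ.2] at hP
  exact ae_of_ae_map measurable_snd.aemeasurable hP

theorem integral_snd_of_mem_lifts {U : Set (Dd d)} {ν : Measure (Em m)}
    {μ : Measure (Dd d × Em m)} (hμ : μ ∈ lifts U ν) {q : Em m → ℝ} (hq : Continuous q) :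
    ∫ p, q p.2 ∂μ = ∫ y, q y ∂ν := by
  rw [← hμ.2, Measure.snd, integral_map measurable_snd.aemeasurable hq.aestronglyMeasurable]

/-- The measure with density `χ i` in the second variable, disintegrated as `κ i` over the `i`-th
piece of the partition. -/
def glue (t : Finset (Em m)) (χ : Em m → Em m → ℝ) (κ : Em m → Measure (Dd d))
    (ν : Measure (Em m)) : Measure (Dd d × Em m) :=
  ∑ i ∈ t, (κ i).prod (ν.withDensity fun y => ENNReal.ofReal (χ i y))

theorem ae_glue_iff {t : Finset (Em m)} {χ : Em m → Em m → ℝ} {κ : Em m → Measure (Dd d)}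
    {ν : Measure (Em m)} {P : Dd d × Em m → Prop} : (∀ᵐ p ∂(glue t χ κ ν), P p) ↔
      ∀ i ∈ t, ∀ᵐ p ∂((κ i).prod (ν.withDensity fun y => ENNReal.ofReal (χ i y))), P p := by
  simp only [ae_iff, glue, Measure.finsetSum_apply, Finset.sum_eq_zero_iff]

theorem glue_mem_lifts {t : Finset (Em m)} {χ : Em m → Em m → ℝ} (hχ : ∀ i, Continuous (χ i))
    (hχ0 : ∀ i y, 0 ≤ χ i y) {ν : Measure (Em m)} [IsFiniteMeasure ν]
    (hχ1 : ∀ᵐ y ∂ν, ∑ i ∈ t, χ i y = 1) {κ : Em m → Measure (Dd d)}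
    [∀ i, IsProbabilityMeasure (κ i)] {U : Set (Dd d)} (hκ : ∀ i, ∀ᵐ u ∂(κ i), u ∈ U) :
    glue t χ κ ν ∈ lifts U ν := by
  refine ⟨ae_glue_iff.2 fun i _ => Measure.quasiMeasurePreserving_fst.ae (hκ i), ?_⟩
  ext s hs
  have h1 : Prod.snd ⁻¹' s = (univ : Set (Dd d)) ×ˢ s := by ext; simp
  rw [Measure.snd_apply hs, glue, Measure.finsetSum_apply, h1]
  simp only [Measure.prod_prod, measure_univ, one_mul, withDensity_apply _ hs]
  rw [← lintegral_finsetSum _ fun i _ => (hχ i).measurable.ennreal_ofReal]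
  calc ∫⁻ y in s, ∑ i ∈ t, ENNReal.ofReal (χ i y) ∂ν = ∫⁻ y in s, 1 ∂ν := by
        refine lintegral_congr_ae (ae_restrict_of_ae ?_)
        filter_upwards [hχ1] with y hy
        rw [← ENNReal.ofReal_sum_of_nonneg fun i _ => hχ0 i y, hy, ENNReal.ofReal_one]
    _ = ν s := by simp

/-- Two lifted sets are close as soon as their base measures give close masses to the pieces of a
fine partition of unity. -/
theorem exists_mem_lifts_levyProkhorovEDist_le {U : Set (Dd d)} (hU : MeasurableSet U)
    {ν ν' : Measure (Em m)} [IsProbabilityMeasure ν] [IsProbabilityMeasure ν'] {t : Finset (Em m)}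
    {χ : Em m → Em m → ℝ} (hχ : ∀ i, Continuous (χ i)) (hχ0 : ∀ i y, 0 ≤ χ i y)
    (hχ1 : ∀ᵐ y ∂ν, ∑ i ∈ t, χ i y = 1) (hχ1' : ∀ᵐ y ∂ν', ∑ i ∈ t, χ i y = 1)
    {δ : ℝ} (hχδ : ∀ i y, χ i y ≠ 0 → dist y i < δ / 2)
    (hδ : ∑ i ∈ t, (∫⁻ y, ENNReal.ofReal (χ i y) ∂ν' - ∫⁻ y, ENNReal.ofReal (χ i y) ∂ν) ≤
      ENNReal.ofReal δ) {μ : Measure (Dd d × Em m)} (hμ : μ ∈ lifts U ν') :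
    ∃ μ' ∈ lifts U ν, levyProkhorovEDist μ μ' ≤ ENNReal.ofReal δ := by
  have := isProbabilityMeasure_of_mem_lifts hμ
  obtain ⟨p₀, hp₀⟩ := hμ.1.exists
  have hm : ∀ i, Measurable fun y => ENNReal.ofReal (χ i y) := fun i =>
    (hχ i).measurable.ennreal_ofReal
  have hmp : ∀ i, Measurable fun p : Dd d × Em m => ENNReal.ofReal (χ i p.2) := fun i =>
    (hm i).comp measurable_snd
  set σ : Em m → Measure (Dd d) := fun i =>
    (μ.withDensity fun p => ENNReal.ofReal (χ i p.2)).fst with hσ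
  set a : Em m → ℝ≥0∞ := fun i => ∫⁻ y, ENNReal.ofReal (χ i y) ∂ν with ha
  set a' : Em m → ℝ≥0∞ := fun i => ∫⁻ y, ENNReal.ofReal (χ i y) ∂ν' with ha'
  have hσu : ∀ i, σ i univ = a' i := by
    intro i
    simp only [hσ, ha']
    rw [Measure.fst_univ, withDensity_apply _ .univ, Measure.restrict_univ, ← hμ.2, Measure.snd,
      lintegral_map (hm i) measurable_snd]
  have ha1 : ∀ i ∈ t, a' i ≠ ∞ := by
    intro i hi
    have h1 : a' i ≤ ∫⁻ _, 1 ∂ν' := by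
      refine lintegral_mono_ae ?_
      filter_upwards [hχ1'] with y hy
      rw [← ENNReal.ofReal_one, ← hy]
      exact ENNReal.ofReal_le_ofReal
        (Finset.single_le_sum (f := fun i => χ i y) (fun i _ => hχ0 i y) hi)
    refine ne_top_of_le_ne_top ENNReal.one_ne_top (h1.trans_eq (by simp))
  have hσU : ∀ i, ∀ᵐ u ∂(σ i), u ∈ U := fun i =>
    (ae_map_iff measurable_fst.aemeasurable hU).2
      ((withDensity_absolutelyContinuous _ _).ae_le hμ.1)
  classical
  set κ : Em m → Measure (Dd d) := fun i =>
    if i ∈ t ∧ a' i ≠ 0 then (a' i)⁻¹ • σ i else Measure.dirac p₀.1 with hκ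
  have hκp : ∀ i, IsProbabilityMeasure (κ i) := fun i => by
    by_cases h : i ∈ t ∧ a' i ≠ 0
    · simp only [hκ, if_pos h]
      exact ⟨by rw [Measure.smul_apply, hσu, smul_eq_mul, ENNReal.inv_mul_cancel h.2 (ha1 i h.1)]⟩
    · simp only [hκ, if_neg h]
      infer_instance
  have hκU : ∀ i, ∀ᵐ u ∂(κ i), u ∈ U := fun i => by
    by_cases h : i ∈ t ∧ a' i ≠ 0
    · simp only [hκ, if_pos h]
      exact Measure.ae_smul_measure (hσU i) _
    · simp only [hκ, if_neg h]
      rw [ae_dirac_eq]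
      exact hp₀
  have hσκ : ∀ i ∈ t, ∀ s, σ i s = a' i * κ i s := fun i hi s => by
    by_cases h : a' i = 0
    · rw [h, zero_mul]
      exact le_antisymm ((measure_mono (subset_univ s)).trans_eq ((hσu i).trans h)) bot_le
    · simp only [hκ, if_pos (And.intro hi h)]
      rw [Measure.smul_apply, smul_eq_mul, ← mul_assoc, ENNReal.mul_inv_cancel h (ha1 i hi),
        one_mul]
  refine ⟨glue t χ κ ν, glue_mem_lifts hχ hχ0 hχ1 hκU, ?_⟩
  have := isProbabilityMeasure_of_mem_lifts (glue_mem_lifts hχ hχ0 hχ1 hκU)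
  refine levyProkhorovEDist_le_of_forall_le _ _ _ fun ε b hε hεt hb => ?_
  have hδε : δ < ε.toReal := by
    by_contra! h
    exact hε.not_ge ((ENNReal.ofReal_toReal hεt.ne).symm.trans_le (ENNReal.ofReal_le_ofReal h))
  have hε0 : 0 < ε.toReal := ENNReal.toReal_pos (bot_le.trans_lt hε).ne' hεt.ne
  set D : Em m → Set (Dd d) := fun i =>
    thickening ε.toReal (Prod.fst '' (b ∩ {p | χ i p.2 ≠ 0})) with hD
  have hDo : ∀ i, IsOpen (D i) := fun i => isOpen_thickening
  have hsub : ∀ i, D i ×ˢ {y | χ i y ≠ 0} ⊆ thickening ε.toReal b := by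
    rintro i ⟨u, y⟩ ⟨hu, hy⟩
    obtain ⟨_, ⟨p, ⟨hpb, hpχ⟩, rfl⟩, hup⟩ := mem_thickening_iff.1 hu
    refine mem_thickening_iff.2 ⟨p, hpb, ?_⟩
    have h1 := hχδ i y hy
    have h2 := hχδ i p.2 hpχ
    have h3 := dist_triangle_right y p.2 i
    rw [Prod.dist_eq]
    exact max_lt hup (by linarith)
  have e1 : μ b ≤ ∑ i ∈ t, σ i (D i) := by
    calc μ b = ∫⁻ p in b, ∑ i ∈ t, ENNReal.ofReal (χ i p.2) ∂μ := by
          rw [← setLIntegral_one]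
          refine lintegral_congr_ae (ae_restrict_of_ae ?_)
          filter_upwards [ae_snd_of_mem_lifts hμ hχ1'] with p hp
          rw [← ENNReal.ofReal_sum_of_nonneg fun i _ => hχ0 i p.2, hp, ENNReal.ofReal_one]
      _ = ∑ i ∈ t, ∫⁻ p in b, ENNReal.ofReal (χ i p.2) ∂μ :=
          lintegral_finsetSum _ fun i _ => hmp i
      _ ≤ ∑ i ∈ t, σ i (D i) := by
          refine Finset.sum_le_sum fun i _ => ?_
          simp only [hσ]
          rw [Measure.fst_apply (hDo i).measurableSet,
            withDensity_apply _ (measurable_fst (hDo i).measurableSet),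
            ← lintegral_indicator hb,
            ← lintegral_indicator (measurable_fst (hDo i).measurableSet)]
          refine lintegral_mono fun p => ?_
          by_cases hpb : p ∈ b
          · by_cases hpχ : χ i p.2 = 0
            · simp [indicator, hpχ]
            · have : p ∈ Prod.fst ⁻¹' D i :=
                self_subset_thickening hε0 _ ⟨p, ⟨hpb, hpχ⟩, rfl⟩
              rw [indicator_of_mem hpb, indicator_of_mem this]
          · rw [indicator_of_notMem hpb]
            exact bot_le
  have e2 : ∀ i ∈ t, σ i (D i) ≤ a i * κ i (D i) + (a' i - a i) := fun i hi => by
    rw [hσκ i hi]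
    calc a' i * κ i (D i) ≤ (a i + (a' i - a i)) * κ i (D i) := by
          gcongr
          exact le_add_tsub
      _ ≤ a i * κ i (D i) + (a' i - a i) := by
          rw [add_mul]
          gcongr
          exact mul_le_of_le_one_right bot_le prob_le_one
  have e3 : ∀ i, a i * κ i (D i) ≤
      ((κ i).prod (ν.withDensity fun y => ENNReal.ofReal (χ i y))) (thickening ε.toReal b) :=
    fun i => by
    refine le_trans ?_ (measure_mono (hsub i))
    rw [Measure.prod_prod, mul_comm]
    gcongr
    have h1 : MeasurableSet {y | χ i y ≠ 0} :=
      (isOpen_ne_fun (hχ i) continuous_const).measurableSet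
    rw [withDensity_apply _ h1, ← lintegral_indicator h1]
    refine lintegral_mono fun y => ?_
    by_cases hy : χ i y = 0
    · simp [hy]
    · rw [indicator_of_mem (s := {y | χ i y ≠ 0}) hy]
  calc μ b ≤ ∑ i ∈ t, (a i * κ i (D i) + (a' i - a i)) := e1.trans (Finset.sum_le_sum e2)
    _ = (∑ i ∈ t, a i * κ i (D i)) + ∑ i ∈ t, (a' i - a i) := Finset.sum_add_distrib
    _ ≤ glue t χ κ ν (thickening ε.toReal b) + ε := by
        refine add_le_add ?_ (hδ.trans hε.le)
        rw [glue, Measure.finsetSum_apply]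
        exact Finset.sum_le_sum fun i _ => e3 i

theorem convex_image_lifts {E : Type*} [NormedAddCommGroup E] [NormedSpace ℝ E] {U : Set (Dd d)}
    {ν : Measure (Em m)} {J : Dd d × Em m → E} (hJ : ∀ μ ∈ lifts U ν, Integrable J μ) :
    Convex ℝ ((fun μ => ∫ p, J p ∂μ) '' lifts U ν) := by
  rintro _ ⟨μ, hμ, rfl⟩ _ ⟨μ', hμ', rfl⟩ a b ha hb hab
  refine ⟨ENNReal.ofReal a • μ + ENNReal.ofReal b • μ', ⟨?_, ?_⟩, ?_⟩
  · rw [ae_add_measure_iff]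
    exact ⟨Measure.ae_smul_measure hμ.1 _, Measure.ae_smul_measure hμ'.1 _⟩
  · rw [Measure.snd, Measure.map_add _ _ measurable_snd, Measure.map_smul, Measure.map_smul]
    change ENNReal.ofReal a • μ.snd + ENNReal.ofReal b • μ'.snd = ν
    rw [hμ.2, hμ'.2, ← add_smul, ← ENNReal.ofReal_add ha hb, hab, ENNReal.ofReal_one, one_smul]
  · simp only
    rw [integral_add_measure ((hJ μ hμ).smul_measure ENNReal.ofReal_ne_top)
      ((hJ μ' hμ').smul_measure ENNReal.ofReal_ne_top), integral_smul_measure,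
      integral_smul_measure, ENNReal.toReal_ofReal ha, ENNReal.toReal_ofReal hb]

/-- A point at distance `ρ` from a convex set is separated from it by a functional of norm at most
one with gap at least `ρ`. -/
theorem exists_norm_le_one_add_infDist_le {E : Type*} [NormedAddCommGroup E] [NormedSpace ℝ E]
    {V : Set E} (hV : Convex ℝ V) (hne : V.Nonempty) {v : E} (hv : 0 < infDist v V) :
    ∃ p : E →L[ℝ] ℝ, ‖p‖ ≤ 1 ∧ ∀ b ∈ V, p v + infDist v V ≤ p b := by
  set ρ := infDist v V with hρ
  obtain ⟨p, s, hps, hsp⟩ := geometric_hahn_banach_open (convex_ball v ρ) isOpen_ball hV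
    disjoint_ball_infDist
  have hvs : p v < s := hps v (mem_ball_self hv)
  have hgap : p v + ρ * ‖p‖ ≤ s := by
    by_contra! h
    have h1 : (s - p v) / ρ < ‖p‖ := by rw [div_lt_iff₀ hv]; linarith
    obtain ⟨x, hx, hxp⟩ := p.exists_lt_apply_of_lt_opNorm h1
    have h2 : ∀ x : E, ‖x‖ < 1 → p v + ρ * p x < s := fun x hx => by
      have := hps (v + ρ • x) (by
        rw [mem_ball_iff_norm, add_sub_cancel_left, norm_smul, Real.norm_of_nonneg hv.le]
        exact mul_lt_of_lt_one_right hv hx)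
      simpa using this
    rw [div_lt_iff₀ hv, Real.norm_eq_abs] at hxp
    have h3 := h2 x hx
    have h4 := h2 (-x) (by rwa [norm_neg])
    rw [map_neg] at h4
    rcases abs_cases (p x) with h5 | h5 <;> rw [h5.1] at hxp <;> linarith
  have hp0 : 0 < ‖p‖ := by
    obtain ⟨b, hb⟩ := hne
    rw [norm_pos_iff]
    rintro rfl
    have := hsp b hb
    simp only [zero_apply] at *
    linarith
  refine ⟨‖p‖⁻¹ • p, ?_, fun b hb => ?_⟩
  · rw [norm_smul, norm_inv, norm_norm, inv_mul_cancel₀ hp0.ne']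
  · have h1 := hsp b hb
    simp only [smul_apply, smul_eq_mul]
    have h2 : ‖p‖⁻¹ * (p v + ρ * ‖p‖) ≤ ‖p‖⁻¹ * p b := by gcongr; linarith
    rwa [mul_add, mul_comm ρ, inv_mul_cancel_left₀ hp0.ne'] at h2

theorem infDist_integral_image_lifts_le {E : Type*} [NormedAddCommGroup E] [NormedSpace ℝ E]
    [CompleteSpace E] {U : Set (Dd d)} (hU : IsCompact U) {Y : Set (Em m)} (hY : IsCompact Y)
    {J : Dd d × Em m → E} {C : ℝ≥0} (hJu : ∀ y, ContinuousOn (fun u => J (u, y)) U)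
    (hJy : ∀ u ∈ U, LipschitzWith C fun y => J (u, y)) {ν ν' : Measure (Em m)}
    [IsProbabilityMeasure ν] [IsProbabilityMeasure ν'] (hν : ∀ᵐ y ∂ν, y ∈ Y)
    (hν' : ∀ᵐ y ∂ν', y ∈ Y) {D : ℝ} (hD0 : 0 ≤ D)
    (hD : ∀ q : Em m → ℝ, LipschitzWith C q → |∫ y, q y ∂ν' - ∫ y, q y ∂ν| ≤ D)
    {μ : Measure (Dd d × Em m)} (hμ : μ ∈ lifts U ν') :
    infDist (∫ p, J p ∂μ) ((fun μ => ∫ p, J p ∂μ) '' lifts U ν) ≤ D := by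
  have hJc : ContinuousOn J (U ×ˢ univ) :=
    continuousOn_prod_of_continuousOn_lipschitzOnWith' _ C
      (fun u hu => (hJy u hu).lipschitzOnWith) fun y _ => hJu y
  have hint : ∀ ν : Measure (Em m), IsProbabilityMeasure ν → (∀ᵐ y ∂ν, y ∈ Y) →
      ∀ μ ∈ lifts U ν, Integrable J μ := by
    intro ν _ hν μ hμ
    have := isProbabilityMeasure_of_mem_lifts hμ
    refine integrable_of_continuousOn_of_isCompact (hU.prod hY) ?_
      (hJc.mono (prod_mono_right (subset_univ Y)))
    filter_upwards [hμ.1, ae_snd_of_mem_lifts hμ hν] with p h1 h2 using ⟨h1, h2⟩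
  have := isProbabilityMeasure_of_mem_lifts hμ
  obtain ⟨p₀, hp₀⟩ := hμ.1.exists
  set V := (fun μ => ∫ p, J p ∂μ) '' lifts U ν with hV
  set v := ∫ p, J p ∂μ with hv
  by_contra! hlt
  have hpos : 0 < infDist v V := hD0.trans_lt hlt
  have hVne : V.Nonempty := nonempty_iff_ne_empty.2 fun h => by simp [h] at hpos
  obtain ⟨p, hp, hpV⟩ := exists_norm_le_one_add_infDist_le
    (convex_image_lifts (hint ν inferInstance hν)) hVne hpos
  have hmin : ∀ y, ∃ u ∈ U, IsMinOn (fun u => p (J (u, y))) U u := fun y =>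
    hU.exists_isMinOn ⟨p₀.1, hp₀⟩ (p.continuous.comp_continuousOn (hJu y))
  choose w hwU hw using hmin
  have hpJ : ∀ u ∈ U, LipschitzWith C fun y => p (J (u, y)) := fun u hu => by
    refine ((p.lipschitz).comp (hJy u hu)).weaken ?_
    exact mul_le_of_le_one_left bot_le hp
  set q : Em m → ℝ := fun y => p (J (w y, y)) with hq
  have hqL : LipschitzWith C q := LipschitzWith.of_le_add_mul C fun y y' => by
    have h1 : q y ≤ p (J (w y', y)) := hw y (hwU y')
    have h2 := (hpJ (w y') (hwU y')).dist_le_mul y y'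
    rw [Real.dist_eq] at h2
    have h3 := le_abs_self (p (J (w y', y)) - p (J (w y', y')))
    simp only [hq] at h1 ⊢
    linarith
  have hqc := hqL.continuous
  have hlow : ∫ y, q y ∂ν' ≤ p v := by
    rw [hv, ← p.integral_comp_comm (hint ν' inferInstance hν' μ hμ),
      ← integral_snd_of_mem_lifts hμ hqc]
    refine integral_mono_ae ?_ (p.integrable_comp (hint ν' inferInstance hν' μ hμ)) ?_
    · have h1 := integrable_of_continuousOn_of_isCompact hY hν' hqc.continuousOn
      rw [← hμ.2] at h1
      exact h1.comp_measurable measurable_snd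
    · filter_upwards [hμ.1] with x hx using hw x.2 hx
  have hup : ∀ δ > 0, p v + infDist v V ≤ ∫ y, q y ∂ν + 2 * C * δ := by
    intro δ hδ
    obtain ⟨t, χ, hχc, hχ0, hχδ, hχ1⟩ := exists_fine_partition hY hδ
    have hmem : glue t χ (fun i => Measure.dirac (w i)) ν ∈ lifts U ν :=
      glue_mem_lifts hχc hχ0 (hν.mono hχ1) fun i => by
        rw [ae_dirac_eq]
        exact hwU i
    set μ' := glue t χ (fun i => Measure.dirac (w i)) ν with hμ'
    have := isProbabilityMeasure_of_mem_lifts hmem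
    refine (hpV _ ⟨μ', hmem, rfl⟩).trans ?_
    have hi := hint ν inferInstance hν μ' hmem
    have hqi : Integrable (fun x : Dd d × Em m => q x.2) μ' := by
      have h1 := integrable_of_continuousOn_of_isCompact hY hν hqc.continuousOn
      rw [← hmem.2] at h1
      exact h1.comp_measurable measurable_snd
    have hae : ∀ᵐ x ∂μ', p (J x) ≤ q x.2 + 2 * C * δ := by
      refine ae_glue_iff.2 fun i _ => ?_
      have h1 : ∀ᵐ u ∂(Measure.dirac (w i)), u = w i := by simp [ae_dirac_eq]
      have h2 : ∀ᵐ y ∂(ν.withDensity fun y => ENNReal.ofReal (χ i y)), dist y i < δ := by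
        rw [ae_withDensity_iff (hχc i).measurable.ennreal_ofReal]
        refine Eventually.of_forall fun y hy => hχδ i y fun h => hy (by simp [h])
      filter_upwards [Measure.quasiMeasurePreserving_fst.ae h1,
        Measure.quasiMeasurePreserving_snd.ae h2] with x hx1 hx2
      have h3 := (le_abs_self _).trans ((hpJ (w i) (hwU i)).dist_le_mul x.2 i)
      have h4 := (le_abs_self _).trans (hqL.dist_le_mul i x.2)
      have h5 : C * dist x.2 i ≤ C * δ := by gcongr
      have h6 : p (J x) = p (J (w i, x.2)) := by rw [← hx1]
      rw [dist_comm i] at h4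
      simp only [hq] at h4 ⊢
      linarith
    simp only
    rw [← p.integral_comp_comm hi]
    refine (integral_mono_ae (p.integrable_comp hi) (hqi.add (integrable_const _)) hae).trans ?_
    refine le_of_eq ?_
    simp only [Pi.add_apply]
    rw [integral_add hqi (integrable_const _), integral_snd_of_mem_lifts hmem hqc]
    simp
  have h1 := (abs_le.1 (hD q hqL)).1
  have h2 : infDist v V - D ≤ 0 := by
    refine le_of_forall_pos_le_add fun ε hε => ?_
    have h3 := hup (ε / (2 * (C + 1))) (by positivity)
    have h4 : 2 * C * (ε / (2 * (C + 1))) ≤ ε := by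
      rw [mul_div_assoc', div_le_iff₀ (by positivity)]
      nlinarith [C.coe_nonneg]
    linarith
  linarith

theorem hausdorffDist_integral_image_lifts_le {E : Type*} [NormedAddCommGroup E] [NormedSpace ℝ E]
    [CompleteSpace E] {U : Set (Dd d)} (hU : IsCompact U) {Y : Set (Em m)} (hY : IsCompact Y)
    {J : Dd d × Em m → E} {C : ℝ≥0} (hJu : ∀ y, ContinuousOn (fun u => J (u, y)) U)
    (hJy : ∀ u ∈ U, LipschitzWith C fun y => J (u, y)) {ν ν' : Measure (Em m)}
    [IsProbabilityMeasure ν] [IsProbabilityMeasure ν'] (hν : ∀ᵐ y ∂ν, y ∈ Y)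
    (hν' : ∀ᵐ y ∂ν', y ∈ Y) {D : ℝ} (hD0 : 0 ≤ D)
    (hD : ∀ q : Em m → ℝ, LipschitzWith C q → |∫ y, q y ∂ν' - ∫ y, q y ∂ν| ≤ D) :
    hausdorffDist ((fun μ => ∫ p, J p ∂μ) '' lifts U ν') ((fun μ => ∫ p, J p ∂μ) '' lifts U ν)
      ≤ D := by
  refine hausdorffDist_le_of_infDist hD0 ?_ ?_
  · rintro _ ⟨μ, hμ, rfl⟩
    exact infDist_integral_image_lifts_le hU hY hJu hJy hν hν' hD0 hD hμ
  · rintro _ ⟨μ, hμ, rfl⟩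
    exact infDist_integral_image_lifts_le hU hY hJu hJy hν' hν hD0
      (fun q hq => by rw [abs_sub_comm]; exact hD q hq) hμ

theorem IsUniquePeriodicOrbit.W_eq_lifts {f : Em m → Em m} {K : ℝ≥0} (hf : LipschitzWith K f)
    {F : Em m → Kk k} {z : Kk k} (hz : IsCompact (lvl F z)) {U : Set (Dd d)} (hU : IsCompact U)
    {y : ℝ → Em m} {T : ℝ} (h : IsUniquePeriodicOrbit f (lvl F z) y T) :
    W U (fun _ => f) F z = lifts U (perOcc y T) := by
  have := h.isProbabilityMeasure
  have hm := hz.isClosed.measurableSet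
  have hstat : ∀ (μ : Measure (Dd d × Em m)) (φ : Em m → ℝ), ContDiff ℝ 1 φ →
      ∫ x, fderiv ℝ φ x (f x) ∂μ.snd = ∫ p, fderiv ℝ φ p.2 (f p.2) ∂μ := fun μ φ hφ => by
    have hc : Continuous fun x => fderiv ℝ φ x (f x) :=
      (hφ.continuous_fderiv (by norm_num)).clm_apply hf.continuous
    rw [Measure.snd, integral_map measurable_snd.aemeasurable hc.aestronglyMeasurable]
  ext μ
  constructor
  · rintro ⟨hμ, hμ1, hμs⟩
    have hae : ∀ᵐ p ∂μ, p ∈ U ×ˢ lvl F z :=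
      (mem_ae_iff_prob_eq_one (hU.measurableSet.prod hm)).2 hμ1
    refine ⟨hae.mono fun p hp => hp.1, h.eq_perOcc hf hz ?_ fun φ hφ => ?_⟩
    · exact (ae_map_iff measurable_snd.aemeasurable hm).2 (hae.mono fun p hp => hp.2)
    · rw [hstat μ φ hφ, hμs φ hφ]
  · intro hμ
    have hp := isProbabilityMeasure_of_mem_lifts hμ
    refine ⟨hp, ?_, fun φ hφ => ?_⟩
    · refine (mem_ae_iff_prob_eq_one (hU.measurableSet.prod hm)).1 ?_
      filter_upwards [hμ.1, ae_snd_of_mem_lifts hμ (h.ae_mem hm)] with p h1 h2 using ⟨h1, h2⟩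
    · rw [← hstat μ φ hφ, hμ.2, h.integral_fderiv_perOcc hf.continuous hφ]

/-- Weak-* continuity of the second marginal gives Lévy–Prokhorov continuity of the lifts. -/
theorem exists_forall_lifts_levyProkhorovEDist_le {U : Set (Dd d)} (hU : MeasurableSet U)
    {Y : Set (Em m)} (hY : IsCompact Y) {Z : Set (Kk k)} {ν : Kk k → Measure (Em m)}
    (hνp : ∀ z ∈ Z, IsProbabilityMeasure (ν z)) (hνY : ∀ z ∈ Z, ∀ᵐ y ∂(ν z), y ∈ Y)
    (hcont : ∀ q : Em m → ℝ, Continuous q → ContinuousOn (fun z => ∫ x, q x ∂(ν z)) Z)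
    {z : Kk k} (hz : z ∈ Z) {δ : ℝ} (hδ : 0 < δ) : ∃ ε > 0, ∀ z' ∈ Z, ‖z' - z‖ < ε →
      (∀ μ ∈ lifts U (ν z'), ∃ μ' ∈ lifts U (ν z), levyProkhorovEDist μ μ' ≤ ENNReal.ofReal δ) ∧
      ∀ μ ∈ lifts U (ν z), ∃ μ' ∈ lifts U (ν z'), levyProkhorovEDist μ μ' ≤ ENNReal.ofReal δ := by
  obtain ⟨t, χ, hχc, hχ0, hχδ, hχ1⟩ := exists_fine_partition hY (half_pos hδ)
  have hc : ContinuousOn (fun z' => ∑ i ∈ t, |∫ x, χ i x ∂(ν z') - ∫ x, χ i x ∂(ν z)|) Z :=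
    continuousOn_finsetSum _ fun i _ => ((hcont _ (hχc i)).sub continuousOn_const).abs
  obtain ⟨ε, hε, h⟩ := Metric.continuousOn_iff.1 hc z hz δ hδ
  have hsum : ∀ z₁ ∈ Z, ∀ z₂ ∈ Z,
      ∑ i ∈ t, |∫ x, χ i x ∂(ν z₁) - ∫ x, χ i x ∂(ν z₂)| ≤ δ →
      ∑ i ∈ t, (∫⁻ x, ENNReal.ofReal (χ i x) ∂(ν z₁) - ∫⁻ x, ENNReal.ofReal (χ i x) ∂(ν z₂)) ≤
        ENNReal.ofReal δ := by
    intro z₁ h₁ z₂ h₂ hle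
    have hof : ∀ z ∈ Z, ∀ i, ∫⁻ x, ENNReal.ofReal (χ i x) ∂(ν z) =
        ENNReal.ofReal (∫ x, χ i x ∂(ν z)) := fun z hz i => by
      have := hνp z hz
      exact (ofReal_integral_eq_lintegral_ofReal (integrable_of_continuousOn_of_isCompact hY
        (hνY z hz) (hχc i).continuousOn) (Eventually.of_forall (hχ0 i))).symm
    refine le_trans ?_ (ENNReal.ofReal_le_ofReal hle)
    rw [ENNReal.ofReal_sum_of_nonneg fun _ _ => abs_nonneg _]
    refine Finset.sum_le_sum fun i _ => ?_
    rw [hof z₁ h₁, hof z₂ h₂, ← ENNReal.ofReal_sub _ (integral_nonneg (hχ0 i))]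
    exact ENNReal.ofReal_le_ofReal (le_abs_self _)
  refine ⟨ε, hε, fun z' hz' hzz => ?_⟩
  have h1 := h z' hz' (by rwa [dist_eq_norm])
  simp only [sub_self, abs_zero, Finset.sum_const_zero, dist_zero_right] at h1
  have h2 := (le_abs_self _).trans h1.le
  have := hνp z hz
  have := hνp z' hz'
  refine ⟨fun μ hμ => ?_, fun μ hμ => ?_⟩
  · exact exists_mem_lifts_levyProkhorovEDist_le hU hχc hχ0 ((hνY z hz).mono hχ1)
      ((hνY z' hz').mono hχ1) hχδ (hsum z' hz' z hz h2) hμ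
  · refine exists_mem_lifts_levyProkhorovEDist_le hU hχc hχ0 ((hνY z' hz').mono hχ1)
      ((hνY z hz).mono hχ1) hχδ (hsum z hz z' hz' ?_) hμ
    simpa only [abs_sub_comm] using h2

/-- Lemma 4.2 of the paper: for an uncontrolled reduced system
satisfying Assumption III, if `z ↦ ∫ q dν_z` is continuous for every continuous `q` and is
Lipschitz with a uniform constant for all `q` Lipschitz with the fixed constant `L₁`
(a Lipschitz constant in `y` of the pair `(h, r)`), then `W` is continuous on `Z`
and `V` is Lipschitz on `Z`. -/
theorem statement11
    {d m k : ℕ}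
    (Uset : Set (Dd d)) (Yset : Set (Em m)) (Zset : Set (Kk k))
    (f0 : Em m → Em m) (F : Em m → Kk k)
    (hU : IsCompact Uset) (hY : IsCompact Yset) (hZ : IsCompact Zset)
    (hfL : ∃ L : ℝ≥0, LipschitzWith L f0)
    (hF : ∃ V : Set (Em m), IsOpen V ∧ Yset ⊆ V ∧ ContDiffOn ℝ 1 F V ∧
      ∃ LF : ℝ≥0, LipschitzOnWith LF (fun y => fderiv ℝ F y) V)
    (hInv : ∀ y ∈ Yset, fderiv ℝ F y (f0 y) = 0)
    (hYzY : ∀ z ∈ Zset, lvl F z ⊆ Yset)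
    (g : Dd d → Em m → Em m) (r : Dd d → Em m → ℝ)
    (hgC : Continuous fun p : Dd d × Em m => g p.1 p.2)
    (hrC : Continuous fun p : Dd d × Em m => r p.1 p.2)
    (hgL : ∃ L : ℝ≥0, ∀ u ∈ Uset, LipschitzWith L (g u))
    (hrL : ∃ L : ℝ≥0, ∀ u ∈ Uset, LipschitzWith L (r u))
    (yper : Kk k → ℝ → Em m) (Tper : Kk k → ℝ)
    (hIII : AssumptionIII f0 F Zset yper Tper)
    (L₁ : ℝ≥0)
    (hL₁ : ∀ u ∈ Uset, LipschitzWith L₁ (fun y => (hObs F g (u, y), r u y)))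
    (hcont : ∀ q : Em m → ℝ, Continuous q →
      ContinuousOn (fun z => ∫ x, q x ∂(perOcc (yper z) (Tper z))) Zset)
    (L : ℝ)
    (hLip : ∀ q : Em m → ℝ, LipschitzWith L₁ q → ∀ z' ∈ Zset, ∀ z'' ∈ Zset,
      |(∫ x, q x ∂(perOcc (yper z') (Tper z'))) -
        ∫ x, q x ∂(perOcc (yper z'') (Tper z''))| ≤ L * ‖z' - z''‖) :
    WCont Uset (fun _ : Dd d => f0) F Zset ∧
      VLip Uset (fun _ : Dd d => f0) F g r Zset := by
  obtain ⟨K, hK⟩ := hfL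
  obtain ⟨V, hVo, hYV, hFV, -⟩ := hF
  obtain ⟨⟨_, hT⟩, hsol, hmem, hper, huniq⟩ := hIII
  have horb : ∀ z ∈ Zset, IsUniquePeriodicOrbit f0 (lvl F z) (yper z) (Tper z) := fun z hz =>
    ⟨(hT z hz).1, hsol z hz, hmem z hz, hper z hz, huniq z hz⟩
  have hlvl : ∀ z ∈ Zset, IsCompact (lvl F z) := fun z hz => by
    have h1 : lvl F z = Yset ∩ F ⁻¹' {z} :=
      (inter_eq_right.2 (hYzY z hz)).symm
    rw [h1]
    exact hY.of_isClosed_subset ((hFV.continuousOn.mono hYV).preimage_isClosed_of_isClosed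
      hY.isClosed isClosed_singleton) inter_subset_left
  have hW : ∀ z ∈ Zset, W Uset (fun _ => f0) F z = lifts Uset (perOcc (yper z) (Tper z)) :=
    fun z hz => (horb z hz).W_eq_lifts hK (hlvl z hz) hU
  have hνp : ∀ z ∈ Zset, IsProbabilityMeasure (perOcc (yper z) (Tper z)) := fun z hz =>
    (horb z hz).isProbabilityMeasure
  have hνY : ∀ z ∈ Zset, ∀ᵐ x ∂(perOcc (yper z) (Tper z)), x ∈ Yset := fun z hz =>
    ((horb z hz).ae_mem (hlvl z hz).isClosed.measurableSet).mono fun x hx => hYzY z hz hx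
  constructor
  · intro z hz δ hδ
    obtain ⟨δ₀, hδ₀, hδ₀δ⟩ := ENNReal.lt_iff_exists_nnreal_btwn.1 hδ
    obtain ⟨ε, hε, h⟩ := exists_forall_lifts_levyProkhorovEDist_le hU.measurableSet hY hνp hνY
      hcont hz (NNReal.coe_pos.2 (ENNReal.coe_pos.1 hδ₀))
    rw [ENNReal.ofReal_coe_nnreal] at h
    refine ⟨ε, hε, fun z' hz' hzz => lt_of_le_of_lt ?_ hδ₀δ⟩
    rw [hW z hz, hW z' hz']
    refine max_le (iSup₂_le fun μ hμ => ?_) (iSup₂_le fun μ hμ => ?_)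
    · obtain ⟨μ', hμ', hle⟩ := (h z' hz' hzz).1 μ hμ
      exact iInf₂_le_of_le μ' hμ' hle
    · obtain ⟨μ', hμ', hle⟩ := (h z' hz' hzz).2 μ hμ
      exact iInf₂_le_of_le μ' hμ' hle
  · set J : Dd d × Em m → Kk k × ℝ := fun p => (hObs F g p, r p.1 p.2) with hJ
    have hJu : ∀ y, ContinuousOn (fun u => J (u, y)) Uset := fun y => by
      refine Continuous.continuousOn (Continuous.prodMk ?_ ?_)
      · exact (fderiv ℝ F y).continuous.comp (hgC.comp (by fun_prop : Continuous fun u => (u, y)))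
      · exact hrC.comp (by fun_prop : Continuous fun u => (u, y))
    have hJc : ContinuousOn J (Uset ×ˢ univ) :=
      continuousOn_prod_of_continuousOn_lipschitzOnWith' _ L₁
        (fun u hu => (hL₁ u hu).lipschitzOnWith) fun y _ => hJu y
    have hV : ∀ z ∈ Zset, Vmap Uset (fun _ => f0) F g r z =
        (fun μ => ∫ p, J p ∂μ) '' lifts Uset (perOcc (yper z) (Tper z)) := fun z hz => by
      have := hνp z hz
      rw [Vmap, hW z hz]
      refine image_congr fun μ hμ => ?_
      have := isProbabilityMeasure_of_mem_lifts hμ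
      have hi : Integrable J μ := by
        refine integrable_of_continuousOn_of_isCompact (hU.prod hY) ?_
          (hJc.mono (prod_mono_right (subset_univ Yset)))
        filter_upwards [hμ.1, ae_snd_of_mem_lifts hμ (hνY z hz)] with p h1 h2 using ⟨h1, h2⟩
      exact (integral_pair hi.fst hi.snd).symm
    refine ⟨max L 0, le_max_right _ _, fun z' hz' z'' hz'' => ?_⟩
    have := hνp z' hz'
    have := hνp z'' hz''
    rw [hV z' hz', hV z'' hz'']
    refine hausdorffDist_integral_image_lifts_le hU hY hJu hL₁ (hνY z'' hz'') (hνY z' hz')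
      (by positivity) fun q hq => (hLip q hq z' hz' z'' hz'').trans ?_
    gcongr
    exact le_max_left _ _

end SlowObs
end
end

section
/- Let Assumption V hold and assume C·R̃*(z₀) = ã*(z₀). If an ACG family (u_z(·), y_z(·)) satisfying the periodicity condition (u_z(τ + T_z), y_z(τ + T_z)) = (u_z(τ), y_z(τ)) for all τ ≥ 0 is optimal, then there exist A ⊂ [0,∞) and, for each t ∈ A, P_t ⊂ [0,∞), whose complements in [0,∞) have Lebesgue measure zero, such that for every t ∈ A and τ ∈ P_t the control value u_{z(t)}(τ) belongs to Argmin_{u∈U} { r(u, y_{z(t)}(τ)) + ∇ζ*(z(t))·h(u, y_{z(t)}(τ)) + ∇η*_{z(t)}(y_{z(t)}(τ))·f(u, y_{z(t)}(τ)) }, where z(·) is the solution of z′(t) = h̃(μ_{z(t)}), z(0) = z₀. -/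
open MeasureTheory Set Filter Metric
open scoped ENNReal NNReal Topology

noncomputable section

namespace SlowObs

variable {d m k : ℕ}

section Curves

variable {E : Type*} [NormedAddCommGroup E] [NormedSpace ℝ E]

/-- A primitive of a bounded function is Lipschitz, with a.e. derivative that function. -/
lemma lipschitzOn_and_ae_hasDerivAt_of_integral_eq [CompleteSpace E] {x w : ℝ → E} {T M : ℝ}
    (hT : 0 ≤ T) (hw : IntervalIntegrable w volume 0 T) (hM : ∀ t, 0 ≤ t → ‖w t‖ ≤ M)
    (hx : ∀ t, 0 ≤ t → x t = x 0 + ∫ s in (0 : ℝ)..t, w s) :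
    LipschitzOnWith M.toNNReal x (uIcc 0 T) ∧
      ∀ᵐ t, t ∈ uIoc 0 T → HasDerivAt x (w t) t := by
  have hM0 : 0 ≤ M := (norm_nonneg _).trans (hM 0 le_rfl)
  rw [uIcc_of_le hT, uIoc_of_le hT]
  constructor
  · refine LipschitzOnWith.of_dist_le_mul fun a ha b hb => ?_
    have hi : ∀ c ∈ Icc 0 T, IntervalIntegrable w volume 0 c := fun c hc =>
      hw.mono_set (by rw [uIcc_of_le hT, uIcc_of_le hc.1]; exact Icc_subset_Icc_right hc.2)
    rw [dist_eq_norm, hx a ha.1, hx b hb.1, add_sub_add_left_eq_sub,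
      intervalIntegral.integral_interval_sub_left (hi a ha) (hi b hb), Real.coe_toNNReal _ hM0,
      Real.dist_eq]
    refine intervalIntegral.norm_integral_le_of_norm_le_const fun s hs => hM s ?_
    have := hs.1
    exact (le_min hb.1 ha.1).trans this.le
  · filter_upwards [hw.ae_hasDerivAt_integral, ae_iff.2 (by simp : volume {t | ¬ t ≠ T} = 0)]
      with t ht htT hmem
    have h := (ht (by rw [uIcc_of_le hT]; exact ⟨hmem.1.le, hmem.2⟩) 0 (by simp)).const_add (x 0)
    refine h.congr_of_eventuallyEq ?_
    filter_upwards [lt_mem_nhds hmem.1] with s hs using hx s hs.le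

/-- Fundamental theorem of calculus for a `C¹` function along a Lipschitz curve. -/
lemma integral_fderiv_along_lipschitz {φ : E → ℝ} (hφ : ContDiff ℝ 1 φ) {x w : ℝ → E} {T : ℝ}
    {K : ℝ≥0} (hx : LipschitzOnWith K x (uIcc 0 T))
    (hd : ∀ᵐ t, t ∈ uIoc 0 T → HasDerivAt x (w t) t) :
    ∫ t in (0 : ℝ)..T, fderiv ℝ φ (x t) (w t) = φ (x T) - φ (x 0) := by
  obtain ⟨L, hL⟩ := LocallyLipschitzOn.exists_lipschitzOnWith_of_compact
    (isCompact_uIcc.image_of_continuousOn hx.continuousOn)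
    (hφ.locallyLipschitz.locallyLipschitzOn (s := x '' uIcc 0 T))
  have hac := (hL.comp hx (mapsTo_image x _)).absolutelyContinuousOnInterval
  rw [← Function.comp_apply (f := φ), ← Function.comp_apply (f := φ) (x := (0 : ℝ)),
    ← hac.integral_deriv_eq_sub]
  refine intervalIntegral.integral_congr_ae ?_
  filter_upwards [hd] with t ht hmem
  exact (((hφ.differentiable one_ne_zero (x t)).hasFDerivAt.comp_hasDerivAt t (ht hmem)).deriv).symm

/-- If a discounted running cost, corrected by the derivative of `ζ` along the curve, is bounded
below by its own discounted mean, then it is almost everywhere equal to this mean. -/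
lemma ae_eq_of_discounted_integral_eq [CompleteSpace E] {ζ : E → ℝ} (hζ : ContDiff ℝ 1 ζ)
    {C : ℝ} (hC : 0 < C) {z w : ℝ → E} {Z : Set E} (hZ : IsCompact Z)
    (hzc : ContinuousOn z (Ici 0)) (hzZ : ∀ t, 0 ≤ t → z t ∈ Z)
    (hw : ∀ T : ℝ, IntervalIntegrable w volume 0 T) {M : ℝ} (hM : ∀ t, 0 ≤ t → ‖w t‖ ≤ M)
    (hz : ∀ t, 0 ≤ t → z t = z 0 + ∫ s in (0 : ℝ)..t, w s)
    {ρ : ℝ → ℝ} (hρm : AEStronglyMeasurable ρ (volume.restrict (Ioi 0)))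
    {M' : ℝ} (hρM : ∀ t, 0 ≤ t → ‖ρ t‖ ≤ M') {a : ℝ}
    (ha : C * ∫ t in Ioi (0 : ℝ), Real.exp (-C * t) * ρ t = a)
    (hge : ∀ t, 0 ≤ t → a ≤ ρ t + fderiv ℝ ζ (z t) (w t) + C * (ζ (z 0) - ζ (z t))) :
    ∀ᵐ t ∂(volume.restrict (Ioi (0 : ℝ))),
      ρ t + fderiv ℝ ζ (z t) (w t) + C * (ζ (z 0) - ζ (z t)) = a := by
  have hexp : IntegrableOn (fun t : ℝ => Real.exp (-C * t)) (Ioi 0) :=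
    integrableOn_exp_mul_Ioi (by linarith) 0
  have hexpI : ∫ t in Ioi (0 : ℝ), Real.exp (-C * t) = C⁻¹ := by
    rw [integral_exp_mul_Ioi (by linarith)]; simp [neg_div_neg_eq]
  have hwm : AEStronglyMeasurable w (volume.restrict (Ioi 0)) := by
    have : Ioi (0 : ℝ) = ⋃ n : ℕ, Ioc (0 : ℝ) n := by
      ext t
      simp only [mem_Ioi, mem_iUnion, mem_Ioc]
      exact ⟨fun h => (exists_nat_ge t).imp fun _ hn => ⟨h, hn⟩, fun ⟨_, h, _⟩ => h⟩
    rw [this, aestronglyMeasurable_iUnion_iff]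
    exact fun n => ((hw n).1).aestronglyMeasurable
  have hzc' : ContinuousOn z (Ioi 0) := hzc.mono Ioi_subset_Ici_self
  have hζz : AEStronglyMeasurable (fun t => ζ (z t)) (volume.restrict (Ioi 0)) :=
    (hζ.continuous.comp_continuousOn hzc').aestronglyMeasurable measurableSet_Ioi
  have hdz : AEStronglyMeasurable (fun t => fderiv ℝ ζ (z t)) (volume.restrict (Ioi 0)) :=
    ((hζ.continuous_fderiv one_ne_zero).comp_continuousOn hzc').aestronglyMeasurable
      measurableSet_Ioi
  have hΦm : AEStronglyMeasurable (fun t => fderiv ℝ ζ (z t) (w t)) (volume.restrict (Ioi 0)) :=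
    isBoundedBilinearMap_apply.continuous.comp_aestronglyMeasurable (hdz.prodMk hwm)
  obtain ⟨B, hB⟩ := hZ.exists_bound_of_continuousOn hζ.continuous.continuousOn
  obtain ⟨D, hD⟩ := hZ.exists_bound_of_continuousOn
    (hζ.continuous_fderiv one_ne_zero).continuousOn
  have hD0 : 0 ≤ D := (norm_nonneg _).trans (hD _ (hzZ 0 le_rfl))
  set κ : ℝ → ℝ := fun t => fderiv ℝ ζ (z t) (w t) + C * (ζ (z 0) - ζ (z t)) with hκ
  have hκm : AEStronglyMeasurable κ (volume.restrict (Ioi 0)) :=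
    hΦm.add ((aestronglyMeasurable_const.sub hζz).const_mul C)
  have hκM : ∀ t, 0 ≤ t → ‖κ t‖ ≤ D * M + C * (B + B) := fun t ht => by
    refine (norm_add_le _ _).trans (add_le_add ?_ ?_)
    · exact ((fderiv ℝ ζ (z t)).le_opNorm _).trans
        (mul_le_mul (hD _ (hzZ t ht)) (hM t ht) (norm_nonneg _) hD0)
    · rw [norm_mul, Real.norm_of_nonneg hC.le]
      exact mul_le_mul_of_nonneg_left ((norm_sub_le _ _).trans
        (add_le_add (hB _ (hzZ 0 le_rfl)) (hB _ (hzZ t ht)))) hC.le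
  have hInt : ∀ {q : ℝ → ℝ} {Q : ℝ}, AEStronglyMeasurable q (volume.restrict (Ioi 0)) →
      (∀ t, 0 ≤ t → ‖q t‖ ≤ Q) → IntegrableOn (fun t => Real.exp (-C * t) * q t) (Ioi 0) :=
    fun hq hQ => hexp.mul_bdd hq
      ((ae_restrict_iff' measurableSet_Ioi).2 (ae_of_all _ fun t ht => hQ t (le_of_lt ht)))
  have hρi := hInt hρm hρM
  have hκi := hInt hκm hκM
  have hsum : IntegrableOn (fun t => Real.exp (-C * t) * ρ t + Real.exp (-C * t) * κ t) (Ioi 0) :=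
    hρi.add hκi
  have hκ0 : ∫ t in Ioi (0 : ℝ), Real.exp (-C * t) * κ t = 0 := by
    refine tendsto_nhds_unique (intervalIntegral_tendsto_integral_Ioi 0 hκi tendsto_id) ?_
    have hφ : ContDiff ℝ 1 fun p : ℝ × E => Real.exp (-C * p.1) * (ζ p.2 - ζ (z 0)) := by
      fun_prop
    have hval : ∀ T : ℝ, 0 ≤ T → Real.exp (-C * T) * (ζ (z T) - ζ (z 0)) =
        ∫ t in (0 : ℝ)..T, Real.exp (-C * t) * κ t := fun T hT => by
      obtain ⟨hL, hd⟩ := lipschitzOn_and_ae_hasDerivAt_of_integral_eq hT (hw T) hM hz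
      have h := integral_fderiv_along_lipschitz hφ (x := fun t => (t, z t))
        (w := fun t => ((1 : ℝ), w t)) (LipschitzWith.id.lipschitzOnWith.prodMk hL)
        (by filter_upwards [hd] with t ht hmem using (hasDerivAt_id t).prodMk (ht hmem))
      simp only [sub_self, mul_zero, sub_zero] at h
      rw [← h]
      refine intervalIntegral.integral_congr fun t _ => ?_
      have h1 : HasFDerivAt (fun p : ℝ × E => Real.exp (-C * p.1))
          (Real.exp (-C * t) • ((-C) • ContinuousLinearMap.fst ℝ ℝ E)) (t, z t) :=
        ((hasFDerivAt_fst (𝕜 := ℝ) (p := (t, z t))).const_mul (-C)).exp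
      have h2 : HasFDerivAt (fun p : ℝ × E => ζ p.2 - ζ (z 0))
          ((fderiv ℝ ζ (z t)).comp (ContinuousLinearMap.snd ℝ ℝ E)) (t, z t) :=
        (((hζ.differentiable one_ne_zero (z t)).hasFDerivAt).comp (t, z t)
          hasFDerivAt_snd).sub_const _
      have h3 : fderiv ℝ (fun p : ℝ × E => Real.exp (-C * p.1) * (ζ p.2 - ζ (z 0))) (t, z t) = _ :=
        (h1.mul h2).fderiv
      simp only [h3, hκ]
      simp
      ring
    have hlim : Tendsto (fun T : ℝ => Real.exp (-C * T) * (B + B)) atTop (𝓝 0) := by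
      have := (Real.tendsto_exp_atBot.comp
        (tendsto_id.const_mul_atTop_of_neg (neg_lt_zero.2 hC))).mul_const (B + B)
      simpa using this
    refine squeeze_zero_norm' ?_ hlim
    filter_upwards [eventually_ge_atTop 0] with T hT
    rw [id, ← hval T hT, norm_mul, Real.norm_of_nonneg (Real.exp_pos _).le]
    exact mul_le_mul_of_nonneg_left ((norm_sub_le _ _).trans
      (add_le_add (hB _ (hzZ T hT)) (hB _ (hzZ 0 le_rfl)))) (Real.exp_pos _).le
  have hzero : ∫ t in Ioi (0 : ℝ), (Real.exp (-C * t) * ρ t + Real.exp (-C * t) * κ t -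
      Real.exp (-C * t) * a) = 0 := by
    rw [integral_sub hsum (hexp.mul_const a), integral_add hρi hκi, hκ0,
      integral_mul_const, hexpI, ← ha]
    field_simp
    ring
  have hnn : 0 ≤ᵐ[volume.restrict (Ioi 0)] fun t => Real.exp (-C * t) * ρ t +
      Real.exp (-C * t) * κ t - Real.exp (-C * t) * a := by
    refine (ae_restrict_iff' measurableSet_Ioi).2 (ae_of_all _ fun t ht => ?_)
    have h := hge t (le_of_lt ht)
    have : 0 ≤ Real.exp (-C * t) * (ρ t + κ t - a) :=
      mul_nonneg (Real.exp_pos _).le (by simp only [hκ]; linarith)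
    simpa only [Pi.zero_apply, mul_sub, mul_add] using this
  filter_upwards [(setIntegral_eq_zero_iff_of_nonneg_ae hnn
    (hsum.sub (hexp.mul_const a))).1 hzero] with t ht
  have : Real.exp (-C * t) * (ρ t + κ t - a) = 0 := by
    simpa only [Pi.zero_apply, mul_sub, mul_add] using ht
  have := (mul_eq_zero.1 this).resolve_left (Real.exp_pos _).ne'
  simp only [hκ] at this
  linarith

end Curves

section Occupational

variable {u : ℝ → Dd d} {y : ℝ → Em m}

lemma aemeasurable_pair (hu : Measurable u) (hy : ContinuousOn y (Ici 0)) (T : ℝ) :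
    AEMeasurable (fun τ => (u τ, y τ)) (volume.restrict (Ioc 0 T)) :=
  hu.aemeasurable.prodMk ((hy.mono fun _ h => le_of_lt h.1).aemeasurable measurableSet_Ioc)

lemma integral_occ {E : Type*} [NormedAddCommGroup E] [NormedSpace ℝ E]
    (hu : Measurable u) (hy : ContinuousOn y (Ici 0)) {T : ℝ} (hT : 0 < T)
    {q : Dd d × Em m → E} (hq : StronglyMeasurable q) :
    ∫ p, q p ∂(occ u y T) = T⁻¹ • ∫ τ in (0 : ℝ)..T, q (u τ, y τ) := by
  rw [occ, integral_smul_measure, integral_map (aemeasurable_pair hu hy T)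
    hq.aestronglyMeasurable, intervalIntegral.integral_of_le hT.le, ENNReal.toReal_inv,
    ENNReal.toReal_ofReal hT.le]

lemma isFiniteMeasure_occ {T : ℝ} (hT : 0 < T) : IsFiniteMeasure (occ u y T) :=
  Measure.smul_finite _ (ENNReal.inv_ne_top.2 (ENNReal.ofReal_pos.2 hT).ne')

lemma eq_add_natCast_mul {α : Type*} {q : ℝ → α} {T : ℝ} (hT : 0 ≤ T)
    (hper : ∀ τ, 0 ≤ τ → q (τ + T) = q τ) (n : ℕ) {τ : ℝ} (hτ : 0 ≤ τ) :
    q (τ + n * T) = q τ := by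
  induction n with
  | zero => simp
  | succ n ih =>
    rw [← ih, ← hper (τ + n * T) (by positivity)]
    congr 1
    push_cast
    ring

lemma integral_natCast_mul_period {q : ℝ → ℝ} {T : ℝ} (hT : 0 ≤ T)
    (hper : ∀ τ, 0 ≤ τ → q (τ + T) = q τ)
    (hq : ∀ S : ℝ, 0 ≤ S → IntervalIntegrable q volume 0 S) (n : ℕ) :
    ∫ τ in (0 : ℝ)..(n * T), q τ = n * ∫ τ in (0 : ℝ)..T, q τ := by
  induction n with
  | zero => simp
  | succ n ih =>
    have h1 : (0 : ℝ) ≤ n * T := by positivity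
    have h2 : (0 : ℝ) ≤ (n + 1 : ℕ) * T := by positivity
    have hshift : ∫ τ in (n * T)..((n + 1 : ℕ) * T), q τ = ∫ τ in (0 : ℝ)..T, q τ := by
      have h3 : ((n + 1 : ℕ) : ℝ) * T = T + n * T := by push_cast; ring
      have h4 := intervalIntegral.integral_comp_add_right (a := 0) (b := T) q (n * T)
      rw [zero_add] at h4
      rw [h3, ← h4]
      refine intervalIntegral.integral_congr fun τ hτ => ?_
      rw [uIcc_of_le hT] at hτ
      exact eq_add_natCast_mul hT hper n hτ.1
    rw [← intervalIntegral.integral_add_adjacent_intervals (hq _ h1)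
      ((hq _ h1).symm.trans (hq _ h2)), ih, hshift]
    push_cast
    ring

/-- The occupational measure generated by a periodic pair is the one of a period. -/
lemma GeneratesOM.eq_occ {μ : Measure (Dd d × Em m)} (hμ : GeneratesOM u y μ)
    (hu : Measurable u) (hy : ContinuousOn y (Ici 0)) {T : ℝ} (hT : 0 < T)
    (hper : ∀ τ, 0 ≤ τ → (u (τ + T), y (τ + T)) = (u τ, y τ)) : μ = occ u y T := by
  have := hμ.1
  have := isFiniteMeasure_occ (u := u) (y := y) hT
  refine ext_of_forall_integral_eq_of_IsFiniteMeasure fun q => ?_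
  rw [integral_occ hu hy hT q.continuous.stronglyMeasurable, smul_eq_mul]
  have hq : ∀ S : ℝ, 0 ≤ S → IntervalIntegrable (fun τ => q (u τ, y τ)) volume 0 S := by
    intro S hS
    rw [intervalIntegrable_iff, uIoc_of_le hS]
    exact Integrable.of_bound (q.continuous.measurable.comp_aemeasurable
      (aemeasurable_pair hu hy S)).aestronglyMeasurable ‖q‖
      (ae_of_all _ fun τ => q.norm_coe_le_norm _)
  have hlim : Tendsto (fun n : ℕ => ((n + 1 : ℕ) : ℝ) * T) atTop atTop :=
    ((tendsto_natCast_atTop_atTop).comp (tendsto_add_atTop_nat 1)).atTop_mul_const hT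
  refine tendsto_nhds_unique ((hμ.2 q q.continuous).comp hlim) ?_
  refine tendsto_const_nhds.congr fun n => ?_
  have hn : ((n + 1 : ℕ) : ℝ) ≠ 0 := by positivity
  rw [Function.comp_apply, integral_natCast_mul_period hT.le
    (fun τ hτ => by rw [hper τ hτ]) hq]
  field_simp

lemma norm_integral_occ_le {E : Type*} [NormedAddCommGroup E] [NormedSpace ℝ E]
    (hu : Measurable u) (hy : ContinuousOn y (Ici 0)) {T : ℝ} (hT : 0 < T)
    {q : Dd d × Em m → E} (hq : StronglyMeasurable q) {M : ℝ}
    (hM : ∀ τ, 0 ≤ τ → ‖q (u τ, y τ)‖ ≤ M) : ‖∫ p, q p ∂(occ u y T)‖ ≤ M := by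
  rw [integral_occ hu hy hT hq, norm_smul, norm_inv, Real.norm_of_nonneg hT.le]
  have h := intervalIntegral.norm_integral_le_of_norm_le_const (a := 0) (b := T) (C := M)
    (f := fun τ => q (u τ, y τ)) fun τ hτ => hM τ (by rw [uIoc_of_le hT.le] at hτ; exact hτ.1.le)
  rw [sub_zero, abs_of_pos hT] at h
  rw [inv_mul_le_iff₀ hT, mul_comm T]
  exact h

end Occupational

section Lagrangian

variable {U : Set (Dd d)} {Y : Set (Em m)} {f g : Dd d → Em m → Em m} {F : Em m → Kk k}
  {r : Dd d → Em m → ℝ} {u : ℝ → Dd d} {y : ℝ → Em m}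

/-- The function minimized over `U × Y_z` in the dual problems of Assumption V. -/
def lagrangian (f g : Dd d → Em m → Em m) (F : Em m → Kk k) (r : Dd d → Em m → ℝ)
    (p : Kk k →L[ℝ] ℝ) (η : Em m → ℝ) (q : Dd d × Em m) : ℝ :=
  r q.1 q.2 + p (hObs F g q) + fderiv ℝ η q.2 (f q.1 q.2)

lemma measurable_hObs (hg : Continuous fun p : Dd d × Em m => g p.1 p.2) :
    Measurable (hObs F g) :=
  isBoundedBilinearMap_apply.continuous.measurable.comp
    (((measurable_fderiv ℝ F).comp measurable_snd).prodMk hg.measurable)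

lemma continuousOn_hObs (hg : Continuous fun p : Dd d × Em m => g p.1 p.2)
    (hF : ContinuousOn (fderiv ℝ F) Y) : ContinuousOn (hObs F g) (U ×ˢ Y) :=
  isBoundedBilinearMap_apply.continuous.comp_continuousOn
    ((hF.comp continuousOn_snd fun _ h => h.2).prodMk hg.continuousOn)

lemma continuous_fderiv_apply_field (hf : Continuous fun p : Dd d × Em m => f p.1 p.2)
    {η : Em m → ℝ} (hη : ContDiff ℝ 1 η) :
    Continuous fun p : Dd d × Em m => fderiv ℝ η p.2 (f p.1 p.2) :=
  isBoundedBilinearMap_apply.continuous.comp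
    (((hη.continuous_fderiv one_ne_zero).comp continuous_snd).prodMk hf)

lemma intervalIntegrable_along {E : Type*} [NormedAddCommGroup E] {K : Set (Dd d × Em m)}
    (hK : IsCompact K) (hu : Measurable u) (hy : ContinuousOn y (Ici 0))
    (hmem : ∀ τ, 0 ≤ τ → (u τ, y τ) ∈ K) {q : Dd d × Em m → E} (hq : StronglyMeasurable q)
    (hqK : ContinuousOn q K) {T : ℝ} (hT : 0 ≤ T) :
    IntervalIntegrable (fun τ => q (u τ, y τ)) volume 0 T := by
  obtain ⟨M, hM⟩ := hK.exists_bound_of_continuousOn hqK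
  rw [intervalIntegrable_iff, uIoc_of_le hT]
  exact Integrable.of_bound
    (hq.aestronglyMeasurable.comp_aemeasurable (aemeasurable_pair hu hy T)) M
    ((ae_restrict_iff' measurableSet_Ioc).2 (ae_of_all _ fun τ hτ => hM _ (hmem τ hτ.1.le)))

lemma intervalIntegrable_lagrangian (hU : IsCompact U) (hY : IsCompact Y)
    (hf : Continuous fun p : Dd d × Em m => f p.1 p.2)
    (hg : Continuous fun p : Dd d × Em m => g p.1 p.2)
    (hr : Continuous fun p : Dd d × Em m => r p.1 p.2) (hF : ContinuousOn (fderiv ℝ F) Y)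
    (hu : Measurable u) (hy : ContinuousOn y (Ici 0))
    (hmem : ∀ τ, 0 ≤ τ → (u τ, y τ) ∈ U ×ˢ Y) (p : Kk k →L[ℝ] ℝ) {η : Em m → ℝ}
    (hη : ContDiff ℝ 1 η) {T : ℝ} (hT : 0 ≤ T) :
    IntervalIntegrable (fun τ => lagrangian f g F r p η (u τ, y τ)) volume 0 T :=
  intervalIntegrable_along (hU.prod hY) hu hy hmem
    ((hr.measurable.add (p.continuous.measurable.comp (measurable_hObs hg))).add
      (continuous_fderiv_apply_field hf hη).measurable).stronglyMeasurable
    ((hr.continuousOn.add (p.continuous.comp_continuousOn (continuousOn_hObs hg hF))).add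
      (continuous_fderiv_apply_field hf hη).continuousOn) hT

/-- Along a closed orbit of the reduced system the drift term of the Lagrangian averages out. -/
lemma average_lagrangian (hU : IsCompact U) (hY : IsCompact Y)
    (hf : Continuous fun p : Dd d × Em m => f p.1 p.2)
    (hg : Continuous fun p : Dd d × Em m => g p.1 p.2)
    (hr : Continuous fun p : Dd d × Em m => r p.1 p.2) (hF : ContinuousOn (fderiv ℝ F) Y)
    (hu : Measurable u) (hy : IsSolOn (fun s x => f (u s) x) y)
    (hmem : ∀ τ, 0 ≤ τ → (u τ, y τ) ∈ U ×ˢ Y) (p : Kk k →L[ℝ] ℝ) {η : Em m → ℝ}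
    (hη : ContDiff ℝ 1 η) {T : ℝ} (hT : 0 < T) (hyT : y T = y 0) :
    T⁻¹ * ∫ τ in (0 : ℝ)..T, lagrangian f g F r p η (u τ, y τ) =
      rtilde r (occ u y T) + p (htilde F g (occ u y T)) := by
  obtain ⟨M, hM⟩ := (hU.prod hY).exists_bound_of_continuousOn
    (f := fun p : Dd d × Em m => f p.1 p.2) hf.continuousOn
  have hfM : ∀ t, 0 ≤ t → ‖f (u t) (y t)‖ ≤ M := fun t ht => hM (u t, y t) (hmem t ht)
  obtain ⟨hL, hd⟩ := lipschitzOn_and_ae_hasDerivAt_of_integral_eq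
    (w := fun t => f (u t) (y t)) hT.le (hy.2.1 T) hfM hy.2.2
  have hdrift : ∫ τ in (0 : ℝ)..T, fderiv ℝ η (y τ) (f (u τ) (y τ)) = 0 := by
    rw [integral_fderiv_along_lipschitz hη hL hd, hyT, sub_self]
  have hK := hU.prod hY
  have hri := intervalIntegrable_along hK hu hy.1 hmem hr.measurable.stronglyMeasurable
    hr.continuousOn hT.le
  have hhi := intervalIntegrable_along hK hu hy.1 hmem
    (measurable_hObs (F := F) hg).stronglyMeasurable (continuousOn_hObs hg hF) hT.le
  have hphi : IntervalIntegrable (fun τ => p (hObs F g (u τ, y τ))) volume 0 T :=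
    ⟨p.integrable_comp hhi.1, p.integrable_comp hhi.2⟩
  have hfi := intervalIntegrable_along hK hu hy.1 hmem
    (continuous_fderiv_apply_field hf hη).measurable.stronglyMeasurable
    (continuous_fderiv_apply_field hf hη).continuousOn hT.le
  have hsplit : ∫ τ in (0 : ℝ)..T, lagrangian f g F r p η (u τ, y τ) =
      (∫ τ in (0 : ℝ)..T, r (u τ) (y τ)) + p (∫ τ in (0 : ℝ)..T, hObs F g (u τ, y τ)) := by
    have h1 := intervalIntegral.integral_add (hri.add hphi) hfi
    have h2 := intervalIntegral.integral_add hri hphi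
    have h3 := p.intervalIntegral_comp_comm hhi
    rw [hdrift, add_zero] at h1
    rw [← h3, ← h2, ← h1]
    rfl
  have hrt : rtilde r (occ u y T) = T⁻¹ • ∫ τ in (0 : ℝ)..T, r (u τ) (y τ) :=
    integral_occ hu hy.1 hT hr.measurable.stronglyMeasurable
  have hht : htilde F g (occ u y T) = T⁻¹ • ∫ τ in (0 : ℝ)..T, hObs F g (u τ, y τ) :=
    integral_occ hu hy.1 hT (measurable_hObs hg).stronglyMeasurable
  rw [hsplit, hrt, hht, map_smul, smul_eq_mul, smul_eq_mul, mul_add]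

/-- The averaged Lagrangian of a periodic pair dominates any lower bound of the Lagrangian along
the pair, and equality of the two forces the Lagrangian to be a.e. constant. -/
lemma GeneratesOM.lagrangian_bound (hU : IsCompact U) (hY : IsCompact Y)
    (hf : Continuous fun p : Dd d × Em m => f p.1 p.2)
    (hg : Continuous fun p : Dd d × Em m => g p.1 p.2)
    (hr : Continuous fun p : Dd d × Em m => r p.1 p.2) (hF : ContinuousOn (fderiv ℝ F) Y)
    (hu : Measurable u) (hy : IsSolOn (fun s x => f (u s) x) y)
    (hmem : ∀ τ, 0 ≤ τ → (u τ, y τ) ∈ U ×ˢ Y) (p : Kk k →L[ℝ] ℝ) {η : Em m → ℝ}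
    (hη : ContDiff ℝ 1 η) {μ : Measure (Dd d × Em m)} (hμ : GeneratesOM u y μ)
    {T : ℝ} (hT : 0 < T) (hper : ∀ τ, 0 ≤ τ → (u (τ + T), y (τ + T)) = (u τ, y τ))
    {H : ℝ} (hH : ∀ τ, 0 ≤ τ → H ≤ lagrangian f g F r p η (u τ, y τ)) :
    H ≤ rtilde r μ + p (htilde F g μ) ∧ (rtilde r μ + p (htilde F g μ) ≤ H →
      ∀ᵐ τ, 0 ≤ τ → lagrangian f g F r p η (u τ, y τ) = H) := by
  have hInt : ∀ S, 0 ≤ S →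
      IntervalIntegrable (fun τ => lagrangian f g F r p η (u τ, y τ) - H) volume 0 S :=
    fun S hS => (intervalIntegrable_lagrangian hU hY hf hg hr hF hu hy.1 hmem p hη hS).sub
      intervalIntegrable_const
  have hS : ∀ n : ℕ, 0 < ((n + 1 : ℕ) : ℝ) * T := fun n => by positivity
  have havg : ∀ n : ℕ, ∫ τ in (0 : ℝ)..((n + 1 : ℕ) * T),
      (lagrangian f g F r p η (u τ, y τ) - H) =
        (n + 1 : ℕ) * T * (rtilde r μ + p (htilde F g μ) - H) := fun n => by
    have hper' : ∀ τ, 0 ≤ τ →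
        (u (τ + (n + 1 : ℕ) * T), y (τ + (n + 1 : ℕ) * T)) = (u τ, y τ) := fun τ hτ =>
      eq_add_natCast_mul (q := fun τ => (u τ, y τ)) hT.le hper (n + 1) hτ
    have hyS : y ((n + 1 : ℕ) * T) = y 0 := by
      have := congrArg Prod.snd (hper' 0 le_rfl)
      rwa [zero_add] at this
    have h := average_lagrangian hU hY hf hg hr hF hu hy hmem p hη (hS n) hyS
    rw [← hμ.eq_occ hu hy.1 (hS n) hper', inv_mul_eq_iff_eq_mul₀ (hS n).ne'] at h
    rw [intervalIntegral.integral_sub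
      (intervalIntegrable_lagrangian hU hY hf hg hr hF hu hy.1 hmem p hη (hS n).le)
      intervalIntegrable_const, h, intervalIntegral.integral_const, smul_eq_mul]
    ring
  have hle : H ≤ rtilde r μ + p (htilde F g μ) := by
    have h := intervalIntegral.integral_nonneg (μ := volume) (hS 0).le fun τ hτ => sub_nonneg.2 (hH τ hτ.1)
    rw [havg 0] at h
    exact sub_nonneg.1 (nonneg_of_mul_nonneg_right h (hS 0))
  refine ⟨hle, fun hge => ?_⟩
  have hae : ∀ n : ℕ, ∀ᵐ τ, τ ∈ Ioc (0 : ℝ) ((n + 1 : ℕ) * T) →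
      lagrangian f g F r p η (u τ, y τ) - H = 0 := fun n => by
    have h0 := havg n
    rw [le_antisymm hge hle, sub_self, mul_zero, intervalIntegral.integral_of_le (hS n).le] at h0
    exact (ae_restrict_iff' measurableSet_Ioc).1 ((setIntegral_eq_zero_iff_of_nonneg_ae
      ((ae_restrict_iff' measurableSet_Ioc).2
        (ae_of_all _ fun τ hτ => sub_nonneg.2 (hH τ hτ.1.le))) (hInt _ (hS n).le).1).1 h0)
  filter_upwards [ae_all_iff.2 hae, Measure.ae_ne volume 0] with τ h hne hτ
  obtain ⟨n, hn⟩ := exists_nat_ge (τ / T)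
  refine sub_eq_zero.1 (h n ⟨hτ.lt_of_ne' hne, ?_⟩)
  rw [div_le_iff₀ hT] at hn
  push_cast
  linarith

end Lagrangian

/-- Corollary 5.4 of the paper: necessity of the pointwise argmin condition
along an optimal periodic ACG family. -/
theorem statement14
    {d m k : ℕ}
    (Uset : Set (Dd d)) (Yset : Set (Em m)) (Zset : Set (Kk k))
    (f g : Dd d → Em m → Em m) (F : Em m → Kk k) (r : Dd d → Em m → ℝ)
    (C : ℝ) (z₀ : Kk k)
    (hU : IsCompact Uset) (hY : IsCompact Yset) (hZ : IsCompact Zset)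
    (hfC : Continuous fun p : Dd d × Em m => f p.1 p.2)
    (hgC : Continuous fun p : Dd d × Em m => g p.1 p.2)
    (hrC : Continuous fun p : Dd d × Em m => r p.1 p.2)
    (hfL : ∃ L : ℝ≥0, ∀ u ∈ Uset, LipschitzWith L (f u))
    (hgL : ∃ L : ℝ≥0, ∀ u ∈ Uset, LipschitzWith L (g u))
    (hrL : ∃ L : ℝ≥0, ∀ u ∈ Uset, LipschitzWith L (r u))
    (hF : ∃ V : Set (Em m), IsOpen V ∧ Yset ⊆ V ∧ ContDiffOn ℝ 1 F V ∧
      ∃ LF : ℝ≥0, LipschitzOnWith LF (fun y => fderiv ℝ F y) V)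
    (hInv : ∀ u ∈ Uset, ∀ y ∈ Yset, fderiv ℝ F y (f u y) = 0)
    (hYzY : ∀ z ∈ Zset, lvl F z ⊆ Yset)
    (hC : 0 < C) (hz₀ : z₀ ∈ Zset)
    (hDne : (Dtilde Uset f F g Zset C z₀).Nonempty)
    (ζs : Kk k → ℝ) (ηs : Kk k → Em m → ℝ)
    (hV : AssumptionV Uset f F g r Zset C z₀ ζs ηs)
    (heq : C * RtildeStar Uset f F g r C z₀ = astar Uset f F g r Zset C z₀)
    (uz : Kk k → ℝ → Dd d) (yz : Kk k → ℝ → Em m)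
    (μz : Kk k → Measure (Dd d × Em m)) (zsol : ℝ → Kk k)
    (hACG : IsACG Uset f F g Zset z₀ uz yz μz zsol)
    (hper : ACGPeriodic Zset uz yz)
    (hopt : ACGOptimal Uset f F g r C z₀ μz zsol) :
    ∃ A : Set ℝ, ∃ P : ℝ → Set ℝ, volume (Ici (0:ℝ) \ A) = 0 ∧
      (∀ t ∈ A, volume (Ici (0:ℝ) \ P t) = 0) ∧
      ∀ t ∈ A, ∀ τ ∈ P t, uz (zsol t) τ ∈ Uset ∧
        ∀ v ∈ Uset,
          r (uz (zsol t) τ) (yz (zsol t) τ) +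
            fderiv ℝ ζs (zsol t) (hObs F g (uz (zsol t) τ, yz (zsol t) τ)) +
            fderiv ℝ (ηs (zsol t)) (yz (zsol t) τ)
              (f (uz (zsol t) τ) (yz (zsol t) τ)) ≤
          r v (yz (zsol t) τ) +
            fderiv ℝ ζs (zsol t) (hObs F g (v, yz (zsol t) τ)) +
            fderiv ℝ (ηs (zsol t)) (yz (zsol t) τ) (f v (yz (zsol t) τ)) := by
  obtain ⟨V, -, hYV, -, LF, hLF⟩ := hF
  have hFc : ContinuousOn (fderiv ℝ F) Yset := hLF.continuousOn.mono hYV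
  obtain ⟨hζ, hη, hleast, hleastz⟩ := hV
  obtain ⟨huc, hys, hyl, hμp, hμα, hμm, hz0, hzc, hzi, hzs, hzZ, -⟩ := hACG
  have hmem : ∀ z ∈ Zset, ∀ τ, 0 ≤ τ → (uz z τ, yz z τ) ∈ Uset ×ˢ Yset := fun z hz τ hτ =>
    ⟨(huc z hz).2 τ hτ, hYzY z hz (hyl z hz τ hτ)⟩
  have hgen : ∀ z ∈ Zset, GeneratesOM (uz z) (yz z) (μz z) := fun z hz => by
    refine ⟨hμp z hz, fun q hq => ?_⟩
    obtain ⟨α, hα, hαle⟩ := hμα q hq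
    rw [tendsto_iff_dist_tendsto_zero]
    refine squeeze_zero' (Eventually.of_forall fun _ => dist_nonneg) ?_ hα
    filter_upwards [eventually_gt_atTop 0] with S hS
    exact hαle z hz S hS
  have hper' : ∀ z ∈ Zset, ∃ T > (0 : ℝ), ∀ τ : ℝ, 0 ≤ τ →
      (uz z (τ + T), yz z (τ + T)) = (uz z τ, yz z τ) := fun z hz => by
    obtain ⟨T, hT, h⟩ := hper z hz
    exact ⟨T, hT, fun τ hτ => Prod.ext (h τ hτ).1 (h τ hτ).2⟩
  have hnorm : ∀ {E : Type} [NormedAddCommGroup E] [NormedSpace ℝ E] {q : Dd d × Em m → E} {M : ℝ},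
      StronglyMeasurable q → (∀ p ∈ Uset ×ˢ Yset, ‖q p‖ ≤ M) → ∀ t, 0 ≤ t →
        ‖∫ p, q p ∂(μz (zsol t))‖ ≤ M := by
    intro E _ _ q M hq hM t ht
    obtain ⟨T, hT, hT'⟩ := hper' _ (hzZ t ht)
    have hu := (huc _ (hzZ t ht)).1
    have hy := (hys _ (hzZ t ht)).1
    rw [(hgen _ (hzZ t ht)).eq_occ hu hy hT hT']
    exact norm_integral_occ_le hu hy hT hq fun τ hτ => hM _ (hmem _ (hzZ t ht) τ hτ)
  obtain ⟨Mr, hMr⟩ := (hU.prod hY).exists_bound_of_continuousOn hrC.continuousOn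
  obtain ⟨Mh, hMh⟩ := (hU.prod hY).exists_bound_of_continuousOn (continuousOn_hObs hgC hFc)
  let L : ℝ → ℝ → ℝ := fun t τ => lagrangian f g F r (fderiv ℝ ζs (zsol t)) (ηs (zsol t))
    (uz (zsol t) τ, yz (zsol t) τ)
  let H : ℝ → ℝ := fun t => Htilde Uset f F g r (fderiv ℝ ζs (zsol t)) (zsol t)
  let G : ℝ → ℝ := fun t => rtilde r (μz (zsol t)) +
    fderiv ℝ ζs (zsol t) (htilde F g (μz (zsol t)))
  have hbound : ∀ t, 0 ≤ t → H t ≤ G t ∧ (G t ≤ H t → ∀ᵐ τ, 0 ≤ τ → L t τ = H t) :=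
    fun t ht => by
      have hz := hzZ t ht
      obtain ⟨T, hT, hT'⟩ := hper' _ hz
      exact (hgen _ hz).lagrangian_bound hU hY hfC hgC hrC hFc (huc _ hz).1 (hys _ hz)
        (hmem _ hz) (fderiv ℝ ζs (zsol t)) (hη _) hT hT' fun τ hτ =>
          (hleastz _ hz).2 (mem_image_of_mem _ ⟨(huc _ hz).2 τ hτ, hyl _ hz τ hτ⟩)
  have hleast' : ∀ t, 0 ≤ t → astar Uset f F g r Zset C z₀ ≤
      H t + C * (ζs z₀ - ζs (zsol t)) := fun t ht => hleast.2 (mem_image_of_mem _ (hzZ t ht))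
  rw [← hopt] at heq
  have hae := ae_eq_of_discounted_integral_eq hζ hC hZ hzc hzZ hzi
    (hnorm (measurable_hObs hgC).stronglyMeasurable hMh) (fun t ht => by rw [hz0]; exact hzs t ht)
    (((hμm _ hrC).comp_aemeasurable
      ((hzc.mono Ioi_subset_Ici_self).aemeasurable measurableSet_Ioi)).aestronglyMeasurable)
    (hnorm hrC.measurable.stronglyMeasurable hMr) heq (fun t ht => by
      have h1 := hleast' t ht
      have h2 := (hbound t ht).1
      rw [hz0]
      simp only [G, rtilde, Function.comp_apply] at h2 ⊢
      linarith)
  rw [ae_restrict_iff' measurableSet_Ioi] at hae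
  refine ⟨{t | 0 ≤ t ∧ ∀ᵐ τ, 0 ≤ τ → L t τ = H t}, fun t => {τ | 0 ≤ τ ∧ L t τ = H t}, ?_, ?_, ?_⟩
  · have hA : ∀ᵐ t, 0 ≤ t → ∀ᵐ τ, 0 ≤ τ → L t τ = H t := by
      filter_upwards [hae, Measure.ae_ne volume 0] with t h hne ht
      refine (hbound t ht).2 ?_
      have h1 := hleast' t ht
      have h2 := h (ht.lt_of_ne' hne)
      rw [hz0] at h2
      simp only [G, rtilde, Function.comp_apply] at h2 ⊢
      linarith
    refine measure_mono_null ?_ (ae_iff.1 hA)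
    exact fun t ht h => ht.2 ⟨ht.1, h ht.1⟩
  · intro t ht
    refine measure_mono_null ?_ (ae_iff.1 ht.2)
    exact fun τ hτ h => hτ.2 ⟨hτ.1, h hτ.1⟩
  · intro t ht τ hτ
    have hz := hzZ t ht.1
    refine ⟨(huc _ hz).2 τ hτ.1, fun v hv => ?_⟩
    exact hτ.2.le.trans ((hleastz _ hz).2
      (mem_image_of_mem _ (x := (v, yz (zsol t) τ)) ⟨hv, hyl _ hz τ hτ.1⟩))

end SlowObs
end
end
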